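/- arXiv:1110.1423 — 6 statements merged into one kernel-verified Lean document; each statement's English description precedes it below -/
import Mathlib

section
/- Let (v_1,…,v_l) be a planar vortex solution and set u_j(x) = ln f_j(x) + v_j(x) (defined for x outside the finite set of points p_{j,k}). Then for every ε ∈ (0,1) there exist constants C(ε) > 0 and R > 0 such that Σ_{i=1}^l ‖∇u_i(x)‖² ≤ C(ε) e^{−(1−ε)‖x‖} for all x with ‖x‖ ≥ R. -/
open MeasureTheory Real Set Filter

noncomputable section

/-- The plane `ℝ²` with the Euclidean norm. -/
abbrev E2 := EuclideanSpace ℝ (Fin 2)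

/-- The Laplacian of a function `f : ℝ² → ℝ`, as the sum of its second partial
derivatives in the coordinate directions. -/
noncomputable def lap (f : E2 → ℝ) (x : E2) : ℝ :=
  ∑ i : Fin 2,
    fderiv ℝ (fun y => fderiv ℝ f y (EuclideanSpace.single i 1)) x (EuclideanSpace.single i 1)

/-- Vortex data for the planar problem: a parameter `μ > 0` and, for each `j = 1, …, l`,
`N j` points `p j k` in the plane (repetitions allowed). -/
structure PlanarVortexData (l : ℕ) where
  μ : ℝ
  μ_pos : 0 < μ
  N : Fin l → ℕ
  p : ∀ j : Fin l, Fin (N j) → E2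

namespace PlanarVortexData

variable {l : ℕ} (D : PlanarVortexData l)

/-- `f_j(x) = Π_{k=1}^{N_j} ‖x − p_{j,k}‖²/(μ + ‖x − p_{j,k}‖²)`. -/
def f (j : Fin l) (x : E2) : ℝ :=
  ∏ k, ‖x - D.p j k‖ ^ 2 / (D.μ + ‖x - D.p j k‖ ^ 2)

/-- `g_j(x) = Σ_{k=1}^{N_j} 4μ/(μ + ‖x − p_{j,k}‖²)²`. -/
def g (j : Fin l) (x : E2) : ℝ :=
  ∑ k, 4 * D.μ / (D.μ + ‖x - D.p j k‖ ^ 2) ^ 2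

end PlanarVortexData

/-- `(v_1, …, v_l)` is a planar vortex solution for the data `D`: each `v_j` is `C²`,
solves `Δ v_j = f_j e^{v_j} + Σ_i f_i e^{v_i} − (l+1) + g_j` on `ℝ²`, and
`v_j(x) → 0` as `‖x‖ → ∞`. -/
def IsPlanarVortexSolution {l : ℕ} (D : PlanarVortexData l) (v : Fin l → E2 → ℝ) : Prop :=
  ∀ j : Fin l,
    ContDiff ℝ 2 (v j) ∧
    (∀ x : E2, lap (v j) x =
      D.f j x * Real.exp (v j x) + ∑ i, D.f i x * Real.exp (v i x) - (l + 1) + D.g j x) ∧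
    Tendsto (v j) (cocompact E2) (nhds 0)

/-- `g` is differentiable near `0`, with first derivative `a` and second derivative `b` at `0`. -/
def D2 (g : ℝ → ℝ) (a b : ℝ) : Prop :=
  ∃ g' : ℝ → ℝ, (∀ᶠ t in nhds (0:ℝ), HasDerivAt g (g' t) t) ∧ g' 0 = a ∧ HasDerivAt g' b 0

theorem D2.hasDerivAt {g : ℝ → ℝ} {a b : ℝ} (h : D2 g a b) : HasDerivAt g a 0 := by
  obtain ⟨g', h1, h2, h3⟩ := h
  have := h1.self_of_nhds
  rwa [h2] at this

theorem D2.add {g k : ℝ → ℝ} {a b c d : ℝ} (h : D2 g a b) (h' : D2 k c d) :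
    D2 (fun t => g t + k t) (a + c) (b + d) := by
  obtain ⟨g', h1, h2, h3⟩ := h
  obtain ⟨k', h1', h2', h3'⟩ := h'
  refine ⟨fun t => g' t + k' t, ?_, by simp [h2, h2'], h3.add h3'⟩
  filter_upwards [h1, h1'] with t ht ht'
  exact ht.add ht'

theorem D2.const_mul {g : ℝ → ℝ} {a b : ℝ} (c : ℝ) (h : D2 g a b) :
    D2 (fun t => c * g t) (c * a) (c * b) := by
  obtain ⟨g', h1, h2, h3⟩ := h
  refine ⟨fun t => c * g' t, ?_, by simp [h2], h3.const_mul c⟩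
  filter_upwards [h1] with t ht
  exact ht.const_mul c

theorem D2.sub {g k : ℝ → ℝ} {a b c d : ℝ} (h : D2 g a b) (h' : D2 k c d) :
    D2 (fun t => g t - k t) (a - c) (b - d) := by
  have := h.add (h'.const_mul (-1))
  convert this using 1
  · ext t; ring
  · ring
  · ring

theorem D2.const (c : ℝ) : D2 (fun _ => c) 0 0 :=
  ⟨fun _ => 0, Eventually.of_forall fun t => hasDerivAt_const t c, rfl, hasDerivAt_const 0 0⟩

theorem D2.sum {ι : Type*} (s : Finset ι) {g : ι → ℝ → ℝ} {a b : ι → ℝ}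
    (h : ∀ j ∈ s, D2 (g j) (a j) (b j)) :
    D2 (fun t => ∑ j ∈ s, g j t) (∑ j ∈ s, a j) (∑ j ∈ s, b j) := by
  classical
  induction s using Finset.induction_on with
  | empty => simpa using D2.const 0
  | insert j s hj ih =>
    simp only [Finset.sum_insert hj]
    exact (h j (Finset.mem_insert_self _ _)).add
      (ih fun i hi => h i (Finset.mem_insert_of_mem hi))

theorem D2.comp {g : ℝ → ℝ} {a b : ℝ} (h : D2 g a b) {F F' : ℝ → ℝ} {c : ℝ}
    (hF : ∀ᶠ z in nhds (g 0), HasDerivAt F (F' z) z) (hF' : HasDerivAt F' c (g 0)) :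
    D2 (fun t => F (g t)) (F' (g 0) * a) (c * a ^ 2 + F' (g 0) * b) := by
  have hg := h.hasDerivAt
  obtain ⟨g', h1, h2, h3⟩ := h
  refine ⟨fun t => F' (g t) * g' t, ?_, by simp [h2], ?_⟩
  · filter_upwards [h1, hg.continuousAt.eventually hF] with t ht ht'
    exact ht'.comp t ht
  · have := (hF'.comp (0:ℝ) hg).mul h3
    refine this.congr_deriv ?_
    simp only [Function.comp_apply, h2]; ring

theorem D2.comp_neg {g : ℝ → ℝ} {a b : ℝ} (h : D2 g a b) :
    D2 (fun t => g (-t)) (-a) b := by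
  obtain ⟨g', h1, h2, h3⟩ := h
  have hc : Tendsto (fun t : ℝ => -t) (nhds 0) (nhds 0) := by
    simpa using (continuous_neg (G := ℝ)).tendsto 0
  refine ⟨fun t => - g' (-t), ?_, by simp [h2], ?_⟩
  · filter_upwards [hc.eventually h1] with t ht
    exact (HasDerivAt.comp t ht (hasDerivAt_neg t)).congr_deriv (by ring)
  · have h3' : HasDerivAt g' b (-(0:ℝ)) := by simpa using h3
    exact (HasDerivAt.comp (0:ℝ) h3' (hasDerivAt_neg (0:ℝ))).neg.congr_deriv (by ring)

theorem D2.congr {g k : ℝ → ℝ} {a b : ℝ} (h : D2 g a b) (e : ∀ᶠ t in nhds (0:ℝ), k t = g t) :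
    D2 k a b := by
  obtain ⟨g', h1, h2, h3⟩ := h
  refine ⟨g', ?_, h2, h3⟩
  filter_upwards [h1, e.eventually_nhds] with t ht ht'
  exact ht.congr_of_eventuallyEq ht'

theorem D2.quad (c β : ℝ) : D2 (fun t => c + (t + β) ^ 2) (2 * β) 2 := by
  refine ⟨fun t => 2 * (t + β), Eventually.of_forall fun t => ?_, by simp, ?_⟩
  · have := (((hasDerivAt_id t).add_const β).pow 2).const_add c
    simpa using this
  · have := ((hasDerivAt_id (0:ℝ)).add_const β).const_mul 2
    simpa using this

theorem D2.le_of_isLocalMax {g : ℝ → ℝ} {a b : ℝ} (h : D2 g a b) (hm : IsLocalMax g 0) :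
    b ≤ 0 := by
  have ha : a = 0 := hm.hasDerivAt_eq_zero h.hasDerivAt
  obtain ⟨g', h1, h2, h3⟩ := h
  by_contra! hb
  have hs := (hasDerivAt_iff_tendsto_slope.1 h3).eventually (lt_mem_nhds hb)
  rw [eventually_nhdsWithin_iff] at hs
  obtain ⟨δ, hδ, hball⟩ := Metric.eventually_nhds_iff.1 ((h1.and hs).and hm)
  have hmono : StrictMonoOn g (Icc 0 (δ/2)) := by
    apply strictMonoOn_of_deriv_pos (convex_Icc _ _)
    · intro t ht
      exact (hball (y := t) (by
        rw [Real.dist_eq, abs_lt]; constructor <;> linarith [ht.1, ht.2])).1.1.continuousAt.continuousWithinAt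
    · intro t ht
      rw [interior_Icc] at ht
      have := hball (y := t) (by
        rw [Real.dist_eq, abs_lt]; constructor <;> linarith [ht.1, ht.2])
      rw [this.1.1.deriv]
      have h4 := this.1.2 ht.1.ne'
      rw [slope_def_field, h2, ha] at h4
      have h5 : 0 < t := ht.1
      simp only [sub_zero] at h4
      exact (div_pos_iff_of_pos_right h5).1 h4
  have h6 := hmono (a := 0) (b := δ/2) ⟨le_rfl, by linarith⟩ ⟨by linarith, le_rfl⟩ (by linarith)
  have h7 := (hball (y := δ/2) (by rw [Real.dist_eq, abs_lt]; constructor <;> linarith)).2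
  linarith

/-- One-sided interior gradient bound on a square, by comparison. -/
theorem grad_bound_aux (G : ℝ → ℝ → ℝ) (M N : ℝ)
    (hc : ContinuousOn (fun z : ℝ × ℝ => G z.1 z.2) (Icc (-1) 1 ×ˢ Icc (-1) 1))
    (hM : ∀ s ∈ Icc (-1:ℝ) 1, ∀ t ∈ Icc (-1:ℝ) 1, |G s t| ≤ M)
    (hD : ∀ s ∈ Icc (-1:ℝ) 1, ∀ t ∈ Icc (-1:ℝ) 1, ∃ a b c d, D2 (fun τ => G (s + τ) t) a b ∧
      D2 (fun τ => G s (t + τ)) c d ∧ |b + d| < N)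
    (a : ℝ) (ha : HasDerivAt (fun t => G 0 t) a 0) : a ≤ 2 * M + N / 2 := by
  have hM0 : 0 ≤ M := le_trans (abs_nonneg _) (hM 0 (by simp) 0 (by simp))
  have hN0 : 0 < N := by
    obtain ⟨_, _, _, _, _, _, h⟩ := hD 0 (by simp) 0 (by simp)
    exact lt_of_le_of_lt (abs_nonneg _) h
  set P : ℝ × ℝ → ℝ := fun z => (1/2) * (G z.1 z.2 - G z.1 (-z.2)) -
    (M * (z.1 ^ 2 + z.2 * (2 - z.2)) + N / 2 * (z.2 * (1 - z.2))) with hP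
  have hsub : Icc (-1:ℝ) 1 ×ˢ Icc (0:ℝ) 1 ⊆ Icc (-1:ℝ) 1 ×ˢ Icc (-1:ℝ) 1 :=
    prod_mono le_rfl (Icc_subset_Icc (by norm_num) le_rfl)
  have hPc : ContinuousOn P (Icc (-1:ℝ) 1 ×ˢ Icc (0:ℝ) 1) := by
    have h1 := hc.mono hsub
    have h2 : ContinuousOn (fun z : ℝ × ℝ => G z.1 (-z.2)) (Icc (-1:ℝ) 1 ×ˢ Icc (0:ℝ) 1) := by
      refine hc.comp (f := fun z : ℝ × ℝ => (z.1, -z.2)) (by fun_prop) ?_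
      rintro ⟨s, t⟩ ⟨hs, ht⟩
      exact ⟨hs, by constructor <;> simp at ht ⊢ <;> linarith⟩
    exact (continuousOn_const.mul (h1.sub h2)).sub (by fun_prop)
  obtain ⟨⟨s, t⟩, ⟨hs, ht⟩, hmax⟩ := (isCompact_Icc.prod isCompact_Icc).exists_isMaxOn
    ⟨((0:ℝ), (0:ℝ)), by simp⟩ hPc
  simp only at hs ht
  have key : P (s, t) ≤ 0 := by
    by_contra! hpos
    have b1 := abs_le.1 (hM s hs t ⟨by linarith [ht.1], ht.2⟩)
    have b2 := abs_le.1 (hM s hs (-t) ⟨by linarith [ht.2], by linarith [ht.1]⟩)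
    simp only [hP] at hpos
    have ht0 : 0 < t := by
      rcases eq_or_lt_of_le ht.1 with h | h
      · rw [← h] at hpos
        simp at hpos
        nlinarith [mul_nonneg hM0 (sq_nonneg s)]
      · exact h
    have htt : 0 ≤ N / 2 * (t * (1 - t)) := by
      have := mul_nonneg ht.1 (sub_nonneg.2 ht.2)
      positivity
    have ht1 : t < 1 := by
      rcases eq_or_lt_of_le ht.2 with h | h
      · rw [h] at hpos b1 b2
        nlinarith [mul_nonneg hM0 (sq_nonneg s)]
      · exact h
    have hs2 : s ^ 2 < 1 := by
      by_contra! h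
      have : 0 ≤ t * (2 - t) := mul_nonneg ht.1 (by linarith)
      nlinarith [mul_nonneg hM0 this, mul_nonneg hM0 (sub_nonneg.2 h)]
    have hs1 := abs_lt.1 ((sq_lt_one_iff_abs_lt_one s).1 hs2)
    obtain ⟨a1, b1, c1, d1, e1, e2, e3⟩ := hD s hs t ⟨by linarith, ht.2⟩
    obtain ⟨a2, b2, c2, d2, f1, f2, f3⟩ := hD s hs (-t) ⟨by linarith [ht.2], by linarith [ht.1]⟩
    have hnhds : Icc (-1:ℝ) 1 ×ˢ Icc (0:ℝ) 1 ∈ nhds (s, t) :=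
      prod_mem_nhds (Icc_mem_nhds hs1.1 hs1.2) (Icc_mem_nhds ht0 ht1)
    have hloc : IsLocalMax P (s, t) := hmax.isLocalMax hnhds
    have m1 : IsLocalMax (fun τ => P (s + τ, t)) 0 := by
      have hcont : Tendsto (fun τ : ℝ => (s + τ, t)) (nhds 0) (nhds (s, t)) := by
        have : Continuous (fun τ : ℝ => (s + τ, t)) := by fun_prop
        simpa using this.tendsto 0
      filter_upwards [hcont.eventually hloc] with τ hτ
      simpa using hτ
    have m2 : IsLocalMax (fun τ => P (s, t + τ)) 0 := by
      have hcont : Tendsto (fun τ : ℝ => (s, t + τ)) (nhds 0) (nhds (s, t)) := by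
        have : Continuous (fun τ : ℝ => (s, t + τ)) := by fun_prop
        simpa using this.tendsto 0
      filter_upwards [hcont.eventually hloc] with τ hτ
      simpa using hτ
    have f2' := f2.comp_neg
    have q1 := ((e1.sub f1).const_mul (1/2)).sub
      ((D2.quad (t * (2 - t) ) s).const_mul M |>.add (D2.const (N / 2 * (t * (1 - t)))))
    have q2 := ((e2.sub f2').const_mul (1/2)).sub
      ((D2.quad (-(s ^ 2 + 1)) (t - 1)).const_mul (-M) |>.add
        ((D2.quad (-(1/4)) (t - 1/2)).const_mul (-(N / 2))))
    have r1 := (q1.congr (k := fun τ => P (s + τ, t)) (Eventually.of_forall fun τ => by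
      simp only [hP]; ring)).le_of_isLocalMax m1
    have r2 := (q2.congr (k := fun τ => P (s, t + τ)) (Eventually.of_forall fun τ => by
      simp only [hP]
      rw [show -(t + τ) = -t + -τ by ring]; ring)).le_of_isLocalMax m2
    have := abs_lt.1 e3
    have := abs_lt.1 f3
    linarith
  -- conclude by differentiating at `0`
  have hle : ∀ t ∈ Icc (0:ℝ) 1, P (0, t) ≤ 0 := fun t' ht' =>
    le_trans (hmax (show ((0:ℝ), t') ∈ _ from ⟨by simp, ht'⟩)) key
  have hder : HasDerivAt (fun t => P (0, t)) (a - (2 * M + N / 2)) 0 := by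
    have ha' : HasDerivAt (fun t => G 0 t) a (-(0:ℝ)) := by simpa using ha
    have h1 := HasDerivAt.comp (0:ℝ) ha' (hasDerivAt_neg (0:ℝ))
    have h2 : HasDerivAt (fun t : ℝ => M * ((0:ℝ) ^ 2 + t * (2 - t)) + N / 2 * (t * (1 - t)))
        (2 * M + N / 2) 0 := by
      have hi := hasDerivAt_id (0:ℝ)
      have := (((hi.mul (hi.const_sub 2)).const_add ((0:ℝ)^2)).const_mul M).add
        ((hi.mul (hi.const_sub 1)).const_mul (N/2))
      refine this.congr_deriv ?_
      simp only [id]; ring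
    have := ((ha.sub h1).const_mul (1/2)).sub h2
    exact this.congr_deriv (by ring)
  have hP0 : P (0, 0) = 0 := by simp [hP]
  by_contra! hlt
  have hsl := (hasDerivAt_iff_tendsto_slope.1 hder).eventually (lt_mem_nhds (sub_pos.2 hlt))
  rw [eventually_nhdsWithin_iff] at hsl
  obtain ⟨δ, hδ, hball⟩ := Metric.eventually_nhds_iff.1 hsl
  have hm : 0 < min (δ / 2) 1 := by positivity
  have := hball (y := min (δ/2) 1) (by
    rw [Real.dist_eq, sub_zero, abs_of_pos hm]
    exact lt_of_le_of_lt (min_le_left _ _) (by linarith)) hm.ne'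
  rw [slope_def_field, hP0, sub_zero, sub_zero, div_pos_iff_of_pos_right hm] at this
  exact absurd (hle _ ⟨hm.le, min_le_right _ _⟩) (not_le.2 this)

theorem grad_bound (G : ℝ → ℝ → ℝ) (M N : ℝ)
    (hc : ContinuousOn (fun z : ℝ × ℝ => G z.1 z.2) (Icc (-1) 1 ×ˢ Icc (-1) 1))
    (hM : ∀ s ∈ Icc (-1:ℝ) 1, ∀ t ∈ Icc (-1:ℝ) 1, |G s t| ≤ M)
    (hD : ∀ s ∈ Icc (-1:ℝ) 1, ∀ t ∈ Icc (-1:ℝ) 1, ∃ a b c d, D2 (fun τ => G (s + τ) t) a b ∧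
      D2 (fun τ => G s (t + τ)) c d ∧ |b + d| < N)
    (a : ℝ) (ha : HasDerivAt (fun t => G 0 t) a 0) : |a| ≤ 2 * M + N / 2 := by
  rw [abs_le]
  refine ⟨?_, grad_bound_aux G M N hc hM hD a ha⟩
  have := grad_bound_aux (fun s t => - G s t) M N hc.neg
    (fun s hs t ht => by simpa using hM s hs t ht) (fun s hs t ht => by
      obtain ⟨a, b, c, d, h1, h2, h3⟩ := hD s hs t ht
      refine ⟨_, _, _, _, (h1.const_mul (-1)).congr (Eventually.of_forall fun τ => by ring),
        (h2.const_mul (-1)).congr (Eventually.of_forall fun τ => by ring), ?_⟩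
      rw [show -1 * b + -1 * d = -(b + d) by ring, abs_neg]
      exact h3) (-a) ha.neg
  linarith

/-- First and second partial derivative in the `i`-th coordinate direction. -/
def HasD2 (f : E2 → ℝ) (x : E2) (i : Fin 2) (a b : ℝ) : Prop :=
  D2 (fun t => f (x + t • EuclideanSpace.single i (1:ℝ))) a b

theorem tendsto_line (x e : E2) : Tendsto (fun t : ℝ => x + t • e) (nhds 0) (nhds x) := by
  have : Continuous (fun t : ℝ => x + t • e) := by fun_prop
  simpa using this.tendsto 0

theorem HasD2.congr {f h : E2 → ℝ} {x : E2} {i : Fin 2} {a b : ℝ} (hf : HasD2 f x i a b)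
    (e : ∀ᶠ y in nhds x, h y = f y) : HasD2 h x i a b :=
  D2.congr hf ((tendsto_line x _).eventually e)

theorem HasD2.le_of_isLocalMax {f : E2 → ℝ} {x : E2} {i : Fin 2} {a b : ℝ}
    (hf : HasD2 f x i a b) (h : IsLocalMax f x) : b ≤ 0 := by
  refine D2.le_of_isLocalMax hf ?_
  filter_upwards [(tendsto_line x (EuclideanSpace.single i (1:ℝ))).eventually h] with t ht
  simpa using ht

theorem normsq_coord (x : E2) : ‖x‖ ^ 2 = x 0 ^ 2 + x 1 ^ 2 := by
  rw [EuclideanSpace.real_norm_sq_eq, Fin.sum_univ_two]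

theorem hasD2_normsq (κ : ℝ) (p x : E2) (i : Fin 2) :
    HasD2 (fun y => κ + ‖y - p‖ ^ 2) x i (2 * (x - p) i) 2 := by
  refine (D2.quad (κ + ‖x - p‖ ^ 2 - (x - p) i ^ 2) ((x - p) i)).congr
    (Eventually.of_forall fun t => ?_)
  simp only [normsq_coord]
  fin_cases i <;> simp <;> ring

theorem hasD2_log_normsq (κ : ℝ) (p x : E2) (i : Fin 2) (h : 0 < κ + ‖x - p‖ ^ 2) :
    HasD2 (fun y => Real.log (κ + ‖y - p‖ ^ 2)) x i
      ((κ + ‖x - p‖ ^ 2)⁻¹ * (2 * (x - p) i))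
      (-((κ + ‖x - p‖ ^ 2) ^ 2)⁻¹ * (2 * (x - p) i) ^ 2 + (κ + ‖x - p‖ ^ 2)⁻¹ * 2) := by
  have h0 := D2.comp (hasD2_normsq κ p x i) (F := Real.log) (F' := fun z => z⁻¹)
    (c := -((κ + ‖x - p‖ ^ 2) ^ 2)⁻¹) ?_ ?_
  · simp only [zero_smul, add_zero] at h0
    exact h0
  · simp only [zero_smul, add_zero]
    filter_upwards [lt_mem_nhds h] with z hz
    exact Real.hasDerivAt_log hz.ne'
  · simp only [zero_smul, add_zero]
    exact hasDerivAt_inv h.ne'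

theorem f_pos {l : ℕ} (D : PlanarVortexData l) (j : Fin l) (x : E2) (hx : ∀ k, x ≠ D.p j k) :
    0 < D.f j x := by
  refine Finset.prod_pos fun k _ => ?_
  have := norm_pos_iff.2 (sub_ne_zero.2 (hx k))
  have := D.μ_pos
  positivity

theorem hasD2_logf {l : ℕ} (D : PlanarVortexData l) (j : Fin l) (x : E2)
    (hx : ∀ k, x ≠ D.p j k) :
    ∃ a b : Fin 2 → ℝ, (∀ i, HasD2 (fun y => Real.log (D.f j y)) x i (a i) (b i)) ∧
      b 0 + b 1 = - D.g j x := by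
  have hμ := D.μ_pos
  have hq : ∀ k, 0 < ‖x - D.p j k‖ := fun k => norm_pos_iff.2 (sub_ne_zero.2 (hx k))
  refine ⟨fun i => ∑ k, ((0 + ‖x - D.p j k‖ ^ 2)⁻¹ * (2 * (x - D.p j k) i) -
      (D.μ + ‖x - D.p j k‖ ^ 2)⁻¹ * (2 * (x - D.p j k) i)),
    fun i => ∑ k, (-((0 + ‖x - D.p j k‖ ^ 2) ^ 2)⁻¹ * (2 * (x - D.p j k) i) ^ 2 +
      (0 + ‖x - D.p j k‖ ^ 2)⁻¹ * 2 -
      (-((D.μ + ‖x - D.p j k‖ ^ 2) ^ 2)⁻¹ * (2 * (x - D.p j k) i) ^ 2 +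
      (D.μ + ‖x - D.p j k‖ ^ 2)⁻¹ * 2)), fun i => ?_, ?_⟩
  · refine HasD2.congr (f := fun y => ∑ k, (Real.log (0 + ‖y - D.p j k‖ ^ 2) -
      Real.log (D.μ + ‖y - D.p j k‖ ^ 2))) (D2.sum Finset.univ fun k _ =>
      (D2.sub (hasD2_log_normsq 0 (D.p j k) x i (by have := hq k; positivity))
        (hasD2_log_normsq D.μ (D.p j k) x i (by positivity)))) ?_
    have : ∀ᶠ y in nhds x, ∀ k, y ≠ D.p j k := by
      rw [eventually_all]
      exact fun k => isOpen_ne.mem_nhds (hx k)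
    filter_upwards [this] with y hy
    have hy' : ∀ k, 0 < ‖y - D.p j k‖ := fun k => norm_pos_iff.2 (sub_ne_zero.2 (hy k))
    rw [PlanarVortexData.f, Real.log_prod (fun k _ => by have := hy' k; positivity)]
    refine Finset.sum_congr rfl fun k _ => ?_
    have := hy' k
    rw [Real.log_div (by positivity) (by positivity), zero_add]
  · simp only [PlanarVortexData.g]
    rw [← Finset.sum_add_distrib, ← Finset.sum_neg_distrib]
    refine Finset.sum_congr rfl fun k _ => ?_
    have h1 := normsq_coord (x - D.p j k)
    have h2 := hq k
    have h3 : (x - D.p j k) 1 ^ 2 = ‖x - D.p j k‖ ^ 2 - (x - D.p j k) 0 ^ 2 := by linarith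
    simp only [mul_pow, h3, zero_add]
    field_simp
    ring

theorem hasD2_of_contDiff {v : E2 → ℝ} (hv : ContDiff ℝ 2 v) (x : E2) (i : Fin 2) :
    HasD2 v x i (fderiv ℝ v x (EuclideanSpace.single i 1))
      (fderiv ℝ (fun y => fderiv ℝ v y (EuclideanSpace.single i 1)) x
        (EuclideanSpace.single i 1)) := by
  have hl : ∀ t : ℝ, HasDerivAt (fun t : ℝ => x + t • (EuclideanSpace.single i (1:ℝ) : E2))
      (EuclideanSpace.single i 1) t := fun t => by
    simpa using ((hasDerivAt_id t).smul_const (EuclideanSpace.single i (1:ℝ) : E2)).const_add x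
  refine ⟨fun t => fderiv ℝ v (x + t • EuclideanSpace.single i (1:ℝ))
    (EuclideanSpace.single i 1), Eventually.of_forall fun t => ?_, by simp, ?_⟩
  · exact ((hv.differentiable (by norm_num)) _).hasFDerivAt.comp_hasDerivAt t (hl t)
  · have hd : DifferentiableAt ℝ (fun y => fderiv ℝ v y (EuclideanSpace.single i (1:ℝ) : E2)) x := by
      have : ContDiff ℝ 1 (fun y => fderiv ℝ v y) := hv.fderiv_right (by norm_num)
      exact (this.differentiable (by norm_num) x).clm_apply (differentiableAt_const _)
    have h0 : HasFDerivAt (fun y => fderiv ℝ v y (EuclideanSpace.single i (1:ℝ) : E2))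
      (fderiv ℝ (fun y => fderiv ℝ v y (EuclideanSpace.single i (1:ℝ) : E2)) x)
      (x + (0:ℝ) • (EuclideanSpace.single i (1:ℝ) : E2)) := by
      simpa using hd.hasFDerivAt
    exact h0.comp_hasDerivAt 0 (hl 0)

theorem hasD2_barrier (x : E2) : ∃ a b : Fin 2 → ℝ,
    (∀ i, HasD2 (fun y => Real.exp (-√(1 + ‖y‖ ^ 2))) x i (a i) (b i)) ∧
      b 0 + b 1 ≤ Real.exp (-√(1 + ‖x‖ ^ 2)) := by
  set q := 1 + ‖x‖ ^ 2 with hq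
  have hqp : 0 < q := by positivity
  have hF : ∀ z : ℝ, 0 < z → HasDerivAt (fun z => Real.exp (-√z))
      (Real.exp (-√z) * (-(1 / (2 * √z)))) z := fun z hz =>
    ((Real.hasDerivAt_sqrt hz.ne').neg).exp
  have hs : 0 < √q := Real.sqrt_pos.2 hqp
  have hF' : HasDerivAt (fun z => Real.exp (-√z) * (-(1 / (2 * √z))))
      (Real.exp (-√q) * (1 / (4 * q) + 1 / (4 * q * √q))) q := by
    have h1 := (((Real.hasDerivAt_sqrt hqp.ne').const_mul 2).inv (by positivity)).neg
    have h2 := (hF q hqp).mul h1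
    have h3 := h2.congr_deriv (g' := Real.exp (-√q) * (1 / (4 * q) + 1 / (4 * q * √q))) (by
      have : q = √q ^ 2 := (Real.sq_sqrt hqp.le).symm
      simp only [Pi.neg_apply, Pi.inv_apply]
      generalize √q = s at *
      rw [this]
      field_simp
      ring)
    refine h3.congr_of_eventuallyEq (Eventually.of_forall fun z => ?_)
    simp [Pi.mul_apply]
  refine ⟨fun i => Real.exp (-√q) * (-(1 / (2 * √q))) * (2 * x i),
    fun i => Real.exp (-√q) * (1 / (4 * q) + 1 / (4 * q * √q)) * (2 * x i) ^ 2 +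
        Real.exp (-√q) * (-(1 / (2 * √q))) * 2, fun i => ?_, ?_⟩
  · have h0 := D2.comp (hasD2_normsq 1 0 x i) (F := fun z => Real.exp (-√z))
      (F' := fun z => Real.exp (-√z) * (-(1 / (2 * √z))))
      (c := Real.exp (-√q) * (1 / (4 * q) + 1 / (4 * q * √q))) ?_ ?_
    · simp only [sub_zero, zero_smul, add_zero, ← hq] at h0
      exact h0
    · simp only [sub_zero, zero_smul, add_zero, ← hq]
      filter_upwards [lt_mem_nhds hqp] with z hz using hF z hz
    · simpa only [sub_zero, zero_smul, add_zero, ← hq] using hF'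
  · have h1 := normsq_coord x
    have h3 : x 1 ^ 2 = q - 1 - x 0 ^ 2 := by linarith
    have e1 : Real.exp (-√q) * (1 / (4 * q) + 1 / (4 * q * √q)) * (2 * x 0) ^ 2 +
        Real.exp (-√q) * (-(1 / (2 * √q))) * 2 +
        (Real.exp (-√q) * (1 / (4 * q) + 1 / (4 * q * √q)) * (2 * x 1) ^ 2 +
        Real.exp (-√q) * (-(1 / (2 * √q))) * 2) =
        Real.exp (-√q) * ((q - 1) / q + (q - 1) / q * (1 / √q) - 2 * (1 / √q)) := by
      simp only [mul_pow, h3]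
      field_simp
      ring
    rw [e1]
    have e2 : (q - 1) / q ≤ 1 := by rw [div_le_one hqp]; linarith
    have e3 : 0 < 1 / √q := by positivity
    have e4 : (q - 1) / q + (q - 1) / q * (1 / √q) - 2 * (1 / √q) ≤ 1 := by
      nlinarith [mul_le_mul_of_nonneg_right e2 e3.le]
    exact mul_le_of_le_one_right (Real.exp_pos _).le e4

theorem decay_aux (w : E2 → ℝ) (R B : ℝ) (hB : 0 < B)
    (hc : ∀ x, R ≤ ‖x‖ → ContinuousAt w x) (hwB : ∀ x, R ≤ ‖x‖ → w x ≤ B)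
    (ht : Tendsto w (cocompact E2) (nhds 0))
    (hD : ∀ x, R ≤ ‖x‖ → ∃ a b : Fin 2 → ℝ, (∀ i, HasD2 w x i (a i) (b i)) ∧ w x ≤ b 0 + b 1) :
    ∃ C > 0, ∀ x, R ≤ ‖x‖ → w x ≤ C * Real.exp (-‖x‖) := by
  set C := B * Real.exp (√(1 + R ^ 2)) with hC
  have hCp : 0 < C := by positivity
  set Φ : E2 → ℝ := fun y => Real.exp (-√(1 + ‖y‖ ^ 2)) with hΦ
  have hle : ∀ x : E2, Φ x ≤ Real.exp (-‖x‖) := fun x => by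
    apply Real.exp_le_exp.2
    have : ‖x‖ ≤ √(1 + ‖x‖ ^ 2) := Real.le_sqrt_of_sq_le (by linarith)
    linarith
  refine ⟨C, hCp, fun y hy => le_trans ?_ (mul_le_mul_of_nonneg_left (hle y) hCp.le)⟩
  by_contra! hlt
  set F : E2 → ℝ := fun y => w y - C * Φ y with hF
  have hFy : 0 < F y := sub_pos.2 hlt
  have hev := ht.eventually (gt_mem_nhds hFy)
  obtain ⟨R2, hR2⟩ : ∃ R2, ∀ x : E2, R2 ≤ ‖x‖ → w x < F y := by
    rw [← Metric.cobounded_eq_cocompact, ← comap_norm_atTop, eventually_comap] at hev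
    obtain ⟨R2, h⟩ := eventually_atTop.1 hev
    exact ⟨R2, fun x hx => h _ hx x rfl⟩
  have hFw : ∀ x, F x < w x := fun x => by
    have : 0 < Φ x := Real.exp_pos _
    simp only [hF]; nlinarith [mul_pos hCp this]
  have hyR2 : ‖y‖ < R2 := by
    by_contra! h
    exact absurd (hR2 y h) (not_lt.2 (hFw y).le)
  have hΦc : Continuous Φ := by fun_prop
  have hK : IsCompact {x : E2 | R ≤ ‖x‖ ∧ ‖x‖ ≤ R2} := by
    refine (isCompact_closedBall (0:E2) R2).of_isClosed_subset ?_ ?_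
    · exact (isClosed_le continuous_const continuous_norm).inter
        (isClosed_le continuous_norm continuous_const)
    · intro x hx; simpa using hx.2
  obtain ⟨x0, hx0, hmax⟩ := hK.exists_isMaxOn ⟨y, hy, hyR2.le⟩ (f := F) (fun x hx =>
    ((hc x hx.1).sub (hΦc.continuousAt.const_mul C)).continuousWithinAt)
  have hx0y : F y ≤ F x0 := hmax (show y ∈ _ from ⟨hy, hyR2.le⟩)
  have h2 : ‖x0‖ < R2 := by
    by_contra! h
    linarith [hR2 x0 h, hFw x0]
  have h1 : R < ‖x0‖ := by
    rcases eq_or_lt_of_le hx0.1 with h | h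
    · exfalso
      have e1 : C * Φ x0 = B := by
        simp only [hC, hΦ, ← h]
        rw [mul_assoc, ← Real.exp_add]; simp
      have := hwB x0 hx0.1
      have e2 : F x0 = w x0 - C * Φ x0 := rfl
      linarith
    · exact h
  have hnh : {x : E2 | R ≤ ‖x‖ ∧ ‖x‖ ≤ R2} ∈ nhds x0 := by
    filter_upwards [(isOpen_lt continuous_const continuous_norm).mem_nhds h1,
      (isOpen_lt continuous_norm continuous_const).mem_nhds h2] with z hz hz'
    exact ⟨le_of_lt hz, le_of_lt hz'⟩
  have hloc := hmax.isLocalMax hnh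
  obtain ⟨a, b, hab, hwb⟩ := hD x0 hx0.1
  obtain ⟨a', b', hab', hwb'⟩ := hasD2_barrier x0
  have key : ∀ i, b i - C * b' i ≤ 0 := fun i =>
    HasD2.le_of_isLocalMax (f := F) (D2.sub (hab i) (D2.const_mul C (hab' i))) hloc
  have e2 : F x0 = w x0 - C * Φ x0 := rfl
  have := mul_le_mul_of_nonneg_left hwb' hCp.le
  have k0 := key 0
  have k1 := key 1
  have e3 : Φ x0 = Real.exp (-√(1 + ‖x0‖ ^ 2)) := rfl
  rw [← e3] at this
  linarith

theorem tendsto_logf {l : ℕ} (D : PlanarVortexData l) (j : Fin l) :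
    Tendsto (fun y => Real.log (D.f j y)) (cocompact E2) (nhds 0) := by
  have hμ := D.μ_pos
  have h1 : Tendsto (D.f j) (cocompact E2) (nhds (∏ _k : Fin (D.N j), (1:ℝ))) := by
    refine tendsto_finsetProd _ fun k _ => ?_
    have hn : Tendsto (fun x : E2 => ‖x - D.p j k‖) (cocompact E2) atTop := by
      refine tendsto_atTop_mono (fun x => norm_sub_norm_le x (D.p j k)) ?_
      exact tendsto_atTop_add_const_right _ _ tendsto_norm_cocompact_atTop
    have h2 : Tendsto (fun x : E2 => D.μ + ‖x - D.p j k‖ ^ 2) (cocompact E2) atTop :=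
      tendsto_atTop_add_const_left _ _ ((tendsto_pow_atTop two_ne_zero).comp hn)
    have h3 := (h2.const_div_atTop D.μ).const_sub 1
    rw [sub_zero] at h3
    refine h3.congr fun x => ?_
    have : D.μ + ‖x - D.p j k‖ ^ 2 ≠ 0 := by positivity
    field_simp
    ring
  rw [Finset.prod_const_one] at h1
  simpa using h1.log one_ne_zero

theorem alg_lower {l : ℕ} (u : Fin l → ℝ) (hu : ∀ j, |u j| ≤ 1 / (2 * ((l:ℝ) + 1))) :
    ∑ j, u j ^ 2 ≤ ∑ j, 2 * (u j * (Real.exp (u j) + ∑ i, Real.exp (u i) - (l + 1))) := by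
  set δ : ℝ := 1 / (2 * ((l:ℝ) + 1)) with hδ
  have hl : (0:ℝ) ≤ l := Nat.cast_nonneg l
  have hδ0 : 0 < δ := by positivity
  have hδl : δ * (l + 1) = 1 / 2 := by rw [hδ]; field_simp
  have hδ1 : δ ≤ 1 := by nlinarith
  set r : Fin l → ℝ := fun j => Real.exp (u j) - 1 - u j with hr
  have hrb : ∀ j, |r j| ≤ δ * |u j| := fun j => by
    have h1 := Real.abs_exp_sub_one_sub_id_le ((hu j).trans hδ1)
    calc |r j| ≤ u j ^ 2 := h1
      _ = |u j| * |u j| := by rw [← sq, sq_abs]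
      _ ≤ δ * |u j| := mul_le_mul_of_nonneg_right (hu j) (abs_nonneg _)
  have hsum : ∑ i, Real.exp (u i) = ∑ i, r i + ∑ i, u i + l := by
    rw [← Finset.sum_add_distrib]
    have : (l:ℝ) = ∑ _i : Fin l, (1:ℝ) := by simp
    rw [this, ← Finset.sum_add_distrib]
    exact Finset.sum_congr rfl fun i _ => by simp only [hr]; ring
  have e1 : ∑ j, 2 * (u j * (Real.exp (u j) + ∑ i, Real.exp (u i) - (l + 1))) =
      2 * (∑ j, u j ^ 2 + ∑ j, u j * r j + (∑ j, u j) * (∑ i, r i + ∑ i, u i)) := by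
    rw [hsum]
    generalize ∑ i, r i + ∑ i, u i = Q
    rw [Finset.sum_mul, ← Finset.sum_add_distrib, ← Finset.sum_add_distrib, Finset.mul_sum]
    exact Finset.sum_congr rfl fun i _ => by simp only [hr]; ring
  rw [e1]
  have e2 : -(δ * ∑ j, u j ^ 2) ≤ ∑ j, u j * r j := by
    rw [Finset.mul_sum, ← Finset.sum_neg_distrib]
    refine Finset.sum_le_sum fun j _ => ?_
    have h1 : |u j * r j| ≤ δ * u j ^ 2 := by
      rw [abs_mul, ← sq_abs (u j)]
      nlinarith [mul_le_mul_of_nonneg_left (hrb j) (abs_nonneg (u j))]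
    exact (abs_le.1 h1).1
  set T := ∑ j, |u j| with hT
  have hT0 : 0 ≤ T := Finset.sum_nonneg fun j _ => abs_nonneg _
  have hS : |∑ j, u j| ≤ T := Finset.abs_sum_le_sum_abs _ _
  have hR : |∑ j, r j| ≤ δ * T := by
    refine (Finset.abs_sum_le_sum_abs _ _).trans ?_
    rw [hT, Finset.mul_sum]
    exact Finset.sum_le_sum fun j _ => hrb j
  have hTT : T ^ 2 ≤ l * ∑ j, u j ^ 2 := by
    have := sq_sum_le_card_mul_sum_sq (s := (Finset.univ : Finset (Fin l))) (f := fun j => |u j|)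
    simpa using this
  have e3 : |(∑ j, u j) * ∑ i, r i| ≤ δ * (l * ∑ j, u j ^ 2) := by
    rw [abs_mul]
    calc _ ≤ T * (δ * T) := mul_le_mul hS hR (abs_nonneg _) hT0
      _ = δ * T ^ 2 := by ring
      _ ≤ _ := mul_le_mul_of_nonneg_left hTT hδ0.le
  have e4 := (abs_le.1 e3).1
  have e5 : δ * ∑ j, u j ^ 2 + δ * (l * ∑ j, u j ^ 2) = 1 / 2 * ∑ j, u j ^ 2 := by
    rw [← hδl]; ring
  nlinarith [sq_nonneg (∑ j, u j)]

theorem alg_upper {l : ℕ} (u : Fin l → ℝ) (M : ℝ) (hu1 : ∀ j, |u j| ≤ 1) (hu : ∀ j, |u j| ≤ M)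
    (j : Fin l) :
    |Real.exp (u j) + ∑ i, Real.exp (u i) - (l + 1)| ≤ 2 * (l + 1) * M := by
  have h1 : ∀ i, |Real.exp (u i) - 1| ≤ 2 * M := fun i =>
    (Real.abs_exp_sub_one_le (hu1 i)).trans (by linarith [hu i])
  have e : Real.exp (u j) + ∑ i, Real.exp (u i) - (l + 1) =
      (Real.exp (u j) - 1) + ∑ i, (Real.exp (u i) - 1) := by
    rw [Finset.sum_sub_distrib]; simp; ring
  rw [e]
  have h2 : |∑ i, (Real.exp (u i) - 1)| ≤ l * (2 * M) := by
    refine (Finset.abs_sum_le_sum_abs _ _).trans ?_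
    refine (Finset.sum_le_sum fun i _ => h1 i).trans ?_
    simp
  calc _ ≤ _ := abs_add_le _ _
    _ ≤ 2 * M + l * (2 * M) := add_le_add (h1 j) h2
    _ = _ := by ring

theorem gradient_normsq (f : E2 → ℝ) (x : E2) (hf : DifferentiableAt ℝ f x) (c : Fin 2 → ℝ)
    (hc : ∀ i, HasDerivAt (fun t : ℝ => f (x + t • EuclideanSpace.single i (1:ℝ))) (c i) 0) :
    ‖gradient f x‖ ^ 2 = c 0 ^ 2 + c 1 ^ 2 := by
  have h : ∀ i, gradient f x i = c i := fun i => by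
    have h0 : HasFDerivAt f (fderiv ℝ f x) (x + (0:ℝ) • (EuclideanSpace.single i (1:ℝ) : E2)) := by
      simpa using hf.hasFDerivAt
    have hl : HasDerivAt (fun t : ℝ => x + t • (EuclideanSpace.single i (1:ℝ) : E2))
        (EuclideanSpace.single i 1) 0 := by
      simpa using
        ((hasDerivAt_id (0:ℝ)).smul_const (EuclideanSpace.single i (1:ℝ) : E2)).const_add x
    have h1 := (h0.comp_hasDerivAt 0 hl).unique (hc i)
    rw [← h1]
    have h2 : inner ℝ (gradient f x) (EuclideanSpace.single i (1:ℝ)) =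
        fderiv ℝ f x (EuclideanSpace.single i 1) := by
      simp [gradient]
    rw [← h2, EuclideanSpace.inner_single_right]
    simp
  rw [normsq_coord, h, h]

/-- for a planar vortex solution, the gradients of the fields
`u_j = ln f_j + v_j` decay exponentially: for every `ε ∈ (0,1)` there are `C(ε) > 0`
and `R > 0` with `Σ_i ‖∇u_i(x)‖² ≤ C(ε) e^{−(1−ε)‖x‖}` for all `‖x‖ ≥ R`. -/
theorem exponential_decay_of_gradient {l : ℕ} (hl : 2 ≤ l)
    (D : PlanarVortexData l) (v : Fin l → E2 → ℝ)
    (hv : IsPlanarVortexSolution D v) :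
    ∀ ε ∈ Set.Ioo (0 : ℝ) 1, ∃ C > (0 : ℝ), ∃ R > (0 : ℝ), ∀ x : E2, R ≤ ‖x‖ →
      ∑ i, ‖gradient (fun y => Real.log (D.f i y) + v i y) x‖ ^ 2 ≤
        C * Real.exp (-(1 - ε) * ‖x‖) := by
  rintro ε ⟨hε0, hε1⟩
  classical
  set U : Fin l → E2 → ℝ := fun j y => Real.log (D.f j y) + v j y with hU
  have hμ := D.μ_pos
  have hl0 : (0:ℝ) < l := by exact_mod_cast (by omega : 0 < l)
  -- radius beyond all vortices
  obtain ⟨R0, hR0⟩ : ∃ R0 : ℝ, ∀ x : E2, R0 ≤ ‖x‖ → ∀ j k, x ≠ D.p j k := by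
    refine ⟨1 + ∑ j, ∑ k, ‖D.p j k‖, fun x hx j k h => ?_⟩
    have h1 : ‖D.p j k‖ ≤ ∑ k, ‖D.p j k‖ :=
      Finset.single_le_sum (f := fun k => ‖D.p j k‖) (fun _ _ => norm_nonneg _) (Finset.mem_univ k)
    have h2 : ∑ k, ‖D.p j k‖ ≤ ∑ j, ∑ k, ‖D.p j k‖ :=
      Finset.single_le_sum (f := fun j => ∑ k, ‖D.p j k‖)
        (fun _ _ => Finset.sum_nonneg fun _ _ => norm_nonneg _) (Finset.mem_univ j)
    rw [h] at hx
    linarith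
  have hexp : ∀ x : E2, R0 ≤ ‖x‖ → ∀ j, Real.exp (U j x) = D.f j x * Real.exp (v j x) :=
    fun x hx j => by rw [hU, Real.exp_add, Real.exp_log (f_pos D j x (hR0 x hx j))]
  have hUdiff : ∀ x : E2, R0 ≤ ‖x‖ → ∀ j, DifferentiableAt ℝ (U j) x := fun x hx j => by
    refine DifferentiableAt.add (DifferentiableAt.log ?_ (f_pos D j x (hR0 x hx j)).ne')
      ((hv j).1.differentiable (by norm_num) x)
    unfold PlanarVortexData.f
    have hdk : ∀ k, DifferentiableAt ℝ
        (fun y : E2 => ‖y - D.p j k‖ ^ 2 / (D.μ + ‖y - D.p j k‖ ^ 2)) x := fun k => by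
      have hd : DifferentiableAt ℝ (fun y : E2 => ‖y - D.p j k‖ ^ 2) x :=
        (differentiableAt_id.sub_const _).norm_sq ℝ
      have hne : D.μ + ‖x - D.p j k‖ ^ 2 ≠ 0 := by positivity
      have hi : DifferentiableAt ℝ (fun y : E2 => (D.μ + ‖y - D.p j k‖ ^ 2)⁻¹) x :=
        DifferentiableAt.comp (g := fun z : ℝ => z⁻¹) x (differentiableAt_inv hne)
          (hd.const_add D.μ)
      simp only [div_eq_mul_inv]
      exact hd.mul hi
    induction (Finset.univ : Finset (Fin (D.N j))) using Finset.induction_on with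
    | empty => simp
    | insert k s hk ih =>
      simp only [Finset.prod_insert hk]
      exact (hdk k).mul ih
  have hUD : ∀ x : E2, R0 ≤ ‖x‖ → ∀ j, ∃ a b : Fin 2 → ℝ, (∀ i, HasD2 (U j) x i (a i) (b i)) ∧
      b 0 + b 1 = Real.exp (U j x) + ∑ i, Real.exp (U i x) - (l + 1) := fun x hx j => by
    obtain ⟨a, b, hab, hb⟩ := hasD2_logf D j x (hR0 x hx j)
    refine ⟨fun i => a i + _, fun i => b i + _,
      fun i => D2.add (hab i) (hasD2_of_contDiff (hv j).1 x i), ?_⟩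
    have h1 := (hv j).2.1 x
    rw [lap, Fin.sum_univ_two] at h1
    simp only [hexp x hx]
    linarith
  have hUt : ∀ j, Tendsto (U j) (cocompact E2) (nhds 0) := fun j => by
    simpa using (tendsto_logf D j).add (hv j).2.2
  set δ : ℝ := 1 / (2 * ((l:ℝ) + 1)) with hδ
  have hδ0 : 0 < δ := by positivity
  have hδ1 : δ ≤ 1 := by
    rw [hδ, div_le_one (by positivity)]; linarith
  obtain ⟨R1, hR1⟩ : ∃ R1, ∀ x : E2, R1 ≤ ‖x‖ → ∀ j, |U j x| ≤ δ := by
    have hev : ∀ᶠ x in cocompact E2, ∀ j, |U j x| ≤ δ := by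
      rw [eventually_all]
      intro j
      have := (hUt j).abs
      rw [abs_zero] at this
      filter_upwards [this.eventually (gt_mem_nhds hδ0)] with x hx using hx.le
    rw [← Metric.cobounded_eq_cocompact, ← comap_norm_atTop, eventually_comap] at hev
    obtain ⟨R2, h⟩ := eventually_atTop.1 hev
    exact ⟨R2, fun x hx => h _ hx x rfl⟩
  set R := max R0 R1 with hR
  have hRR0 : R0 ≤ R := le_max_left _ _
  have hRR1 : R1 ≤ R := le_max_right _ _
  -- decay of the sum of squares
  obtain ⟨C, hC, hdec⟩ := decay_aux (fun x => ∑ j, U j x ^ 2) R l hl0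
    (fun x hx => by
      refine tendsto_finsetSum _ fun j _ => ?_
      exact ((hUdiff x (hRR0.trans hx) j).continuousAt.pow 2))
    (fun x hx => by
      have : ∀ j ∈ (Finset.univ : Finset (Fin l)), U j x ^ 2 ≤ 1 := fun j _ => by
        rw [sq_le_one_iff_abs_le_one]
        exact (hR1 x (hRR1.trans hx) j).trans hδ1
      simpa using Finset.sum_le_sum this)
    (by
      have := tendsto_finsetSum (Finset.univ : Finset (Fin l)) fun j _ => (hUt j).pow 2
      simpa using this)
    (fun x hx => by
      choose a b hab hb using hUD x (hRR0.trans hx)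
      refine ⟨fun i => ∑ j, (2 * U j x) * a j i,
        fun i => ∑ j, (2 * a j i ^ 2 + (2 * U j x) * b j i), fun i => ?_, ?_⟩
      · refine D2.sum Finset.univ fun j _ => ?_
        have h0 := D2.comp (hab j i) (F := fun z => z ^ 2) (F' := fun z => 2 * z) (c := 2)
          (Eventually.of_forall fun z => by simpa using hasDerivAt_pow 2 z)
          (by simpa using (hasDerivAt_id _).const_mul (2:ℝ))
        simp only [zero_smul, add_zero] at h0
        exact h0
      · refine (alg_lower (fun j => U j x) (hR1 x (hRR1.trans hx))).trans ?_
        rw [← Finset.sum_add_distrib]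
        refine Finset.sum_le_sum fun j _ => ?_
        rw [← hb j]
        nlinarith [sq_nonneg (a j 0), sq_nonneg (a j 1)])
  have hUb : ∀ x : E2, R ≤ ‖x‖ → ∀ j, |U j x| ≤ √C * Real.exp (-(‖x‖ / 2)) := fun x hx j => by
    refine abs_le_of_sq_le_sq ?_ (by positivity)
    have h1 : U j x ^ 2 ≤ ∑ j, U j x ^ 2 :=
      Finset.single_le_sum (f := fun j => U j x ^ 2) (fun _ _ => sq_nonneg _) (Finset.mem_univ j)
    refine (h1.trans (hdec x hx)).trans (le_of_eq ?_)
    rw [mul_pow, Real.sq_sqrt hC.le, ← Real.exp_nat_mul]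
    congr 2; push_cast; ring
  -- gradient bound
  set K : ℝ := 2 + 2 * (l + 1) with hK
  have hgrad : ∀ x : E2, R + 2 ≤ ‖x‖ → ∀ j, ∀ i i' : Fin 2, i ≠ i' → ∀ a : ℝ,
      HasDerivAt (fun t : ℝ => U j (x + t • EuclideanSpace.single i (1:ℝ))) a 0 →
      |a| ≤ K * (√C * Real.exp (-((‖x‖ - 2) / 2))) := by
    intro x hx j i i' hii a ha
    set M : ℝ := √C * Real.exp (-((‖x‖ - 2) / 2)) with hM
    have hM0 : 0 < M := by positivity
    set G : ℝ → ℝ → ℝ := fun s t =>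
      U j (x + s • EuclideanSpace.single i' (1:ℝ) + t • EuclideanSpace.single i (1:ℝ)) with hG
    have hnorm : ∀ s ∈ Icc (-1:ℝ) 1, ∀ t ∈ Icc (-1:ℝ) 1, ‖x‖ - 2 ≤
        ‖x + s • (EuclideanSpace.single i' (1:ℝ) : E2) + t • (EuclideanSpace.single i (1:ℝ) : E2)‖ := by
      intro s hs t ht
      have h1 : ‖s • (EuclideanSpace.single i' (1:ℝ) : E2)‖ ≤ 1 := by
        rw [norm_smul]; simpa using abs_le.2 hs
      have h2 : ‖t • (EuclideanSpace.single i (1:ℝ) : E2)‖ ≤ 1 := by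
        rw [norm_smul]; simpa using abs_le.2 ht
      have h3 := norm_sub_le_norm_add x (s • (EuclideanSpace.single i' (1:ℝ) : E2))
      have h4 := norm_sub_le_norm_add (x + s • (EuclideanSpace.single i' (1:ℝ) : E2))
        (t • (EuclideanSpace.single i (1:ℝ) : E2))
      linarith
    have hMb : ∀ z : E2, ‖x‖ - 2 ≤ ‖z‖ → ∀ j, |U j z| ≤ M := fun z hz j => by
      refine (hUb z (by linarith) j).trans ?_
      refine mul_le_mul_of_nonneg_left (Real.exp_le_exp.2 (by linarith)) (Real.sqrt_nonneg _)
    have := grad_bound G M (4 * (l + 1) * M) ?_ ?_ ?_ a (by simpa [hG] using ha)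
    · refine this.trans (le_of_eq ?_)
      rw [hK]; ring
    · rintro ⟨s, t⟩ ⟨hs, ht⟩
      have h1 := (hUdiff _ (hRR0.trans (le_trans (by linarith) (hnorm s hs t ht))) j).continuousAt
      refine ContinuousAt.continuousWithinAt ?_
      exact ContinuousAt.comp (f := fun z : ℝ × ℝ => x + z.1 • EuclideanSpace.single i' (1:ℝ) +
        z.2 • (EuclideanSpace.single i (1:ℝ) : E2)) (x := (s, t)) h1 (by fun_prop)
    · intro s hs t ht
      exact hMb _ (hnorm s hs t ht) j
    · intro s hs t ht
      have hn := hnorm s hs t ht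
      set z : E2 := x + s • EuclideanSpace.single i' (1:ℝ) + t • EuclideanSpace.single i (1:ℝ)
        with hz
      have hzR : R ≤ ‖z‖ := by linarith
      obtain ⟨a, b, hab, hb⟩ := hUD z (hRR0.trans hzR) j
      refine ⟨a i', b i', a i, b i, D2.congr (hab i') (Eventually.of_forall fun τ => ?_),
        D2.congr (hab i) (Eventually.of_forall fun τ => ?_), ?_⟩
      · simp only [hG, hz]; congr 1; module
      · simp only [hG, hz]; congr 1; module
      · have h1 : b i' + b i = b 0 + b 1 := by
          fin_cases i <;> fin_cases i' <;> first | exact absurd rfl hii | simp [add_comm]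
        rw [h1, hb]
        refine (alg_upper (fun j => U j z) M
          (fun j => (hR1 z (hRR1.trans hzR) j).trans hδ1) (hMb z hn) j).trans_lt ?_
        have : 0 < (l + 1) * M := by positivity
        linarith
  refine ⟨l * (2 * (K ^ 2 * (C * Real.exp 2))), by positivity, max (R + 2) 1, by positivity,
    fun x hx => ?_⟩
  have hx2 : R + 2 ≤ ‖x‖ := (le_max_left _ _).trans hx
  have hxR0 : R0 ≤ ‖x‖ := by linarith
  have hterm : ∀ j ∈ (Finset.univ : Finset (Fin l)), ‖gradient (U j) x‖ ^ 2 ≤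
      2 * (K ^ 2 * (C * Real.exp 2)) * Real.exp (-‖x‖) := fun j _ => by
    obtain ⟨a, b, hab, -⟩ := hUD x hxR0 j
    rw [gradient_normsq (U j) x (hUdiff x hxR0 j) a fun i => (hab i).hasDerivAt]
    have h0 := hgrad x hx2 j 0 1 (by decide) _ (hab 0).hasDerivAt
    have h1 := hgrad x hx2 j 1 0 (by decide) _ (hab 1).hasDerivAt
    have hsq : (K * (√C * Real.exp (-((‖x‖ - 2) / 2)))) ^ 2 =
        K ^ 2 * (C * Real.exp 2) * Real.exp (-‖x‖) := by
      rw [mul_pow, mul_pow, Real.sq_sqrt hC.le, ← Real.exp_nat_mul, mul_assoc (K ^ 2),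
        mul_assoc C, ← Real.exp_add]
      congr 3; push_cast; ring
    have s0 := sq_le_sq' (abs_le.1 h0).1 (abs_le.1 h0).2
    have s1 := sq_le_sq' (abs_le.1 h1).1 (abs_le.1 h1).2
    rw [hsq] at s0 s1
    linarith
  refine (Finset.sum_le_sum hterm).trans ?_
  rw [Finset.sum_const, Finset.card_univ, Fintype.card_fin, nsmul_eq_mul, ← mul_assoc]
  refine mul_le_mul_of_nonneg_left (Real.exp_le_exp.2 ?_) (by positivity)
  nlinarith [norm_nonneg x]
end
end

section
/- Let L be the l×l lower triangular real matrix (indices 1 ≤ k, j ≤ l) with L_{kk} = √((k+1)/k), L_{jk} = √(1/(k(k+1))) for j > k, and L_{jk} = 0 for j < k. Then L·Lᵀ = A; i.e., L is the Cholesky factor of A. -/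
open Matrix

/-- The `l×l` matrix with diagonal entries `2` and off-diagonal entries `1`. -/
def matA (l : ℕ) : Matrix (Fin l) (Fin l) ℝ :=
  fun j k => if j = k then 2 else 1

/-- The lower triangular matrix `L` with (1-based) entries `L_{kk} = √((k+1)/k)`,
`L_{jk} = √(1/(k(k+1)))` for `j > k`, and `L_{jk} = 0` for `j < k`.
(Here the `Fin l` index `k` corresponds to the 1-based index `k+1`.) -/
noncomputable def matL (l : ℕ) : Matrix (Fin l) (Fin l) ℝ :=
  fun j k =>
    if j = k then Real.sqrt (((k : ℕ) + 2 : ℝ) / ((k : ℕ) + 1 : ℝ))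
    else if (k : ℕ) < (j : ℕ) then
      Real.sqrt (1 / ((((k : ℕ) : ℝ) + 1) * (((k : ℕ) : ℝ) + 2)))
    else 0

noncomputable def auxF (j k : ℕ) : ℝ :=
  if j = k then Real.sqrt (((k : ℕ) + 2 : ℝ) / ((k : ℕ) + 1 : ℝ))
    else if k < j then
      Real.sqrt (1 / (((k : ℝ) + 1) * ((k : ℝ) + 2)))
    else 0

lemma auxF_sum (i : ℕ) : ∑ m ∈ Finset.range i, (1 / (((m : ℝ) + 1) * ((m : ℝ) + 2)))
    = 1 - 1 / ((i : ℝ) + 1) := by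
  induction i with
  | zero => simp
  | succ n ih =>
    rw [Finset.sum_range_succ, ih]
    push_cast
    have h1 : (n : ℝ) + 1 ≠ 0 := by positivity
    have h2 : (n : ℝ) + 2 ≠ 0 := by positivity
    have h3 : (n : ℝ) + 1 + 1 ≠ 0 := by positivity
    field_simp
    ring

lemma auxF_main (l i j : ℕ) (hi : i < l) (hij : i ≤ j) :
    ∑ m ∈ Finset.range l, auxF i m * auxF j m = if i = j then 2 else 1 := by
  have hs : ∑ m ∈ Finset.range l, auxF i m * auxF j m
      = ∑ m ∈ Finset.range (i + 1), auxF i m * auxF j m := by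
    symm
    apply Finset.sum_subset
    · intro m hm
      simp only [Finset.mem_range] at *
      omega
    · intro m _ hm
      simp only [Finset.mem_range] at hm
      have h1 : i ≠ m := by omega
      have h2 : ¬ m < i := by omega
      simp [auxF, h1, h2]
  have ht : ∑ m ∈ Finset.range i, auxF i m * auxF j m
      = ∑ m ∈ Finset.range i, (1 / (((m : ℝ) + 1) * ((m : ℝ) + 2))) := by
    apply Finset.sum_congr rfl
    intro m hm
    simp only [Finset.mem_range] at hm
    have h1 : i ≠ m := by omega
    have h2 : j ≠ m := by omega
    have h3 : m < j := by omega
    unfold auxF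
    rw [if_neg h1, if_pos hm, if_neg h2, if_pos h3]
    exact Real.mul_self_sqrt (by positivity)
  rw [hs, Finset.sum_range_succ, ht, auxF_sum]
  have h1 : (i : ℝ) + 1 ≠ 0 := by positivity
  have h2 : (i : ℝ) + 2 ≠ 0 := by positivity
  by_cases h : i = j
  · subst h
    unfold auxF
    rw [if_pos rfl, if_pos rfl, Real.mul_self_sqrt (by positivity)]
    field_simp
    ring
  · have h3 : i < j := by omega
    unfold auxF
    rw [if_neg h, if_pos rfl, if_neg (Ne.symm h), if_pos h3, ← Real.sqrt_mul (by positivity)]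
    have : ((i : ℝ) + 2) / (i + 1) * (1 / ((i + 1) * (i + 2))) = (1 / ((i : ℝ) + 1)) ^ 2 := by
      field_simp
    rw [this, Real.sqrt_sq (by positivity)]
    ring

lemma matL_eq_auxF (l : ℕ) (j k : Fin l) : matL l j k = auxF j k := by
  simp only [matL, auxF, Fin.ext_iff]

/-- `L·Lᵀ = A`, i.e. `L` is the Cholesky factor of `A`. -/
theorem matL_cholesky {l : ℕ} (hl : 2 ≤ l) :
    matL l * (matL l)ᵀ = matA l := by
  ext i j
  rw [Matrix.mul_apply]
  simp only [Matrix.transpose_apply, matL_eq_auxF, matA, Fin.ext_iff]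
  rw [Fin.sum_univ_eq_sum_range (fun m => auxF i m * auxF j m) l]
  rcases le_total (i : ℕ) (j : ℕ) with h | h
  · exact auxF_main l i j i.2 h
  · have := auxF_main l j i j.2 h
    simp only [mul_comm (auxF i _)]
    rw [this]
    simp only [eq_comm]
end

section
/- For every continuously differentiable, compactly supported function v : ℝ² → ℝ one has the interpolation inequality ∫_{ℝ²} v(x)⁴ dx ≤ 2 (∫_{ℝ²} v(x)² dx) (∫_{ℝ²} ‖∇v(x)‖² dx). -/
open MeasureTheory Real

lemma aux_one (f f' : ℝ → ℝ) (hf : ∀ t, HasDerivAt f (f' t) t) (hc : Continuous f')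
    (hs : HasCompactSupport f) (t : ℝ) : f t ^ 2 ≤ ∫ s, |2 * (f s * f' s)| := by
  have hcf : Continuous f := continuous_iff_continuousAt.2 fun t => (hf t).continuousAt
  have hd : ∀ s, HasDerivAt (fun s => f s ^ 2) (2 * (f s * f' s)) s := by
    intro s
    have := (hf s).pow 2
    refine (this.congr_deriv ?_)
    push_cast; ring
  have hde : deriv (fun s => f s ^ 2) = fun s => 2 * (f s * f' s) := funext fun s => (hd s).deriv
  have h1 : ContDiff ℝ 1 (fun s => f s ^ 2) := by
    rw [contDiff_one_iff_deriv]
    refine ⟨fun s => (hd s).differentiableAt, ?_⟩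
    rw [hde]; fun_prop
  have hs2 : HasCompactSupport (fun s => f s ^ 2) :=
    hs.comp_left (g := fun y : ℝ => y ^ 2) (by norm_num)
  have h2 := hs2.integral_Iic_deriv_eq h1 t
  have hint : Integrable (fun s => |2 * (f s * f' s)|) := by
    apply Continuous.integrable_of_hasCompactSupport
    · fun_prop
    · exact (hs.mul_right (f' := f')).mul_left (f := fun _ => (2:ℝ)) |>.comp_left (g := fun y : ℝ => |y|) abs_zero
  rw [hde] at h2
  simp only at h2
  rw [← h2]
  calc _ ≤ ∫ s in Set.Iic t, |2 * (f s * f' s)| :=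
        (le_abs_self _).trans (abs_integral_le_integral_abs)
    _ ≤ _ := setIntegral_le_integral hint (Filter.Eventually.of_forall fun s => abs_nonneg _)

lemma aux_cs (w u : ℝ × ℝ → ℝ) (hw : Continuous w) (hu : Continuous u)
    (sw : HasCompactSupport w) (su : HasCompactSupport u) :
    (∫ p, |2 * (w p * u p)|) ^ 2 ≤ 4 * ((∫ p, w p ^ 2) * ∫ p, u p ^ 2) := by
  have i1 : Integrable (fun p => w p ^ 2) := Continuous.integrable_of_hasCompactSupport (by fun_prop)
    (sw.comp_left (g := fun y : ℝ => y ^ 2) (by norm_num))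
  have i2 : Integrable (fun p => u p ^ 2) := Continuous.integrable_of_hasCompactSupport (by fun_prop)
    (su.comp_left (g := fun y : ℝ => y ^ 2) (by norm_num))
  have i3 : Integrable (fun p => |2 * (w p * u p)|) := by
    apply Continuous.integrable_of_hasCompactSupport
    · fun_prop
    · exact (sw.mul_right (f' := u)).mul_left (f := fun _ => (2:ℝ)) |>.comp_left (g := fun y : ℝ => |y|) abs_zero
  have key : ∀ t : ℝ, 0 ≤ (∫ p, w p ^ 2) * (t * t) + (-(∫ p, |2 * (w p * u p)|)) * t + ∫ p, u p ^ 2 := by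
    intro t
    have h : 0 ≤ ∫ p, (w p ^ 2 * (t * t) - |2 * (w p * u p)| * t + u p ^ 2) := by
      apply integral_nonneg
      intro p
      have : 0 ≤ (|w p| * t - |u p|) ^ 2 := sq_nonneg _
      simp only [Pi.zero_apply, abs_mul, abs_two]
      nlinarith [sq_abs (w p), sq_abs (u p)]
    have i5 : Integrable (fun p => w p ^ 2 * (t * t) - |2 * (w p * u p)| * t) :=
      (i1.mul_const _).sub (i3.mul_const _)
    rw [integral_add i5 i2,
      integral_sub (i1.mul_const _) (i3.mul_const _), integral_mul_const, integral_mul_const] at h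
    linarith
  have := discrim_le_zero key
  unfold discrim at this
  nlinarith

lemma aux_plane (w u₁ u₂ : ℝ × ℝ → ℝ) (hw : Continuous w) (h₁ : Continuous u₁) (h₂ : Continuous u₂)
    (sw : HasCompactSupport w) (s₁ : HasCompactSupport u₁) (s₂ : HasCompactSupport u₂)
    (d₁ : ∀ a b, HasDerivAt (fun s => w (s, b)) (u₁ (a, b)) a)
    (d₂ : ∀ a b, HasDerivAt (fun s => w (a, s)) (u₂ (a, b)) b) :
    ∫ p, w p ^ 4 ≤ 2 * (∫ p, w p ^ 2) * ∫ p, (u₁ p ^ 2 + u₂ p ^ 2) := by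
  have int : ∀ u : ℝ × ℝ → ℝ, Continuous u → Integrable (fun p => |2 * (w p * u p)|) := by
    intro u hu
    apply Continuous.integrable_of_hasCompactSupport
    · fun_prop
    · exact (sw.mul_right (f' := u)).mul_left (f := fun _ => (2:ℝ)) |>.comp_left (g := fun y : ℝ => |y|) abs_zero
  have isq : ∀ u : ℝ × ℝ → ℝ, Continuous u → HasCompactSupport u → Integrable (fun p => u p ^ 2) :=
    fun u hu su => Continuous.integrable_of_hasCompactSupport (by fun_prop)
      (su.comp_left (g := fun y : ℝ => y ^ 2) (by norm_num))
  have i4 : Integrable (fun p => w p ^ 4) := Continuous.integrable_of_hasCompactSupport (by fun_prop)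
      (sw.comp_left (g := fun y : ℝ => y ^ 4) (by norm_num))
  have j₁ := int u₁ h₁
  have j₂ := int u₂ h₂
  set F : ℝ → ℝ := fun b => ∫ a, |2 * (w (a, b) * u₁ (a, b))| with hF
  set G : ℝ → ℝ := fun a => ∫ b, |2 * (w (a, b) * u₂ (a, b))| with hG
  have iF : Integrable F := Integrable.integral_prod_right (μ := volume) (ν := volume) j₁
  have iG : Integrable G := Integrable.integral_prod_left (μ := volume) (ν := volume) j₂
  have eF : ∫ b, F b = ∫ p, |2 * (w p * u₁ p)| := (integral_prod_symm (μ := volume) (ν := volume) _ j₁).symm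
  have eG : ∫ b, G b = ∫ p, |2 * (w p * u₂ p)| := (integral_prod (μ := volume) (ν := volume) _ j₂).symm
  have hwF : ∀ a b, w (a, b) ^ 2 ≤ F b := fun a b =>
    aux_one (fun s => w (s, b)) (fun s => u₁ (s, b)) (fun s => d₁ s b) (by fun_prop)
      (sw.comp_isClosedEmbedding (g := fun s : ℝ => (s, b))
        (Function.LeftInverse.isClosedEmbedding (f := Prod.fst) (fun _ => rfl) (by fun_prop) (by fun_prop))) a
  have hwG : ∀ a b, w (a, b) ^ 2 ≤ G a := fun a b =>
    aux_one (fun s => w (a, s)) (fun s => u₂ (a, s)) (fun s => d₂ a s) (by fun_prop)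
      (sw.comp_isClosedEmbedding (g := fun s : ℝ => (a, s))
        (Function.LeftInverse.isClosedEmbedding (f := Prod.snd) (fun _ => rfl) (by fun_prop) (by fun_prop))) b
  have step : ∫ p, w p ^ 4 ≤ ∫ p : ℝ × ℝ, G p.1 * F p.2 := by
    refine integral_mono i4 (iG.mul_prod iF) ?_
    rintro ⟨a, b⟩
    have := mul_le_mul (hwG a b) (hwF a b) (sq_nonneg _) ((sq_nonneg _).trans (hwG a b))
    simp only
    nlinarith
  have e : ∫ p : ℝ × ℝ, G p.1 * F p.2 = (∫ a, G a) * ∫ b, F b := integral_prod_mul G F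
  rw [e, eF, eG] at step
  rw [integral_add (isq u₁ h₁ s₁) (isq u₂ h₂ s₂)]
  have c₁ := aux_cs w u₁ hw h₁ sw s₁
  have c₂ := aux_cs w u₂ hw h₂ sw s₂
  nlinarith [sq_nonneg ((∫ p, |2 * (w p * u₁ p)|) - ∫ p, |2 * (w p * u₂ p)|)]

lemma aux_grad (v : E2 → ℝ) (x : E2) :
    ‖gradient v x‖ ^ 2 = (fderiv ℝ v x (EuclideanSpace.single 0 1)) ^ 2
      + (fderiv ℝ v x (EuclideanSpace.single 1 1)) ^ 2 := by
  have h : ∀ i, gradient v x i = fderiv ℝ v x (EuclideanSpace.single i 1) := by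
    intro i
    have : inner ℝ (gradient v x) (EuclideanSpace.single i (1:ℝ)) = fderiv ℝ v x (EuclideanSpace.single i 1) := by
      simp only [gradient, InnerProductSpace.toDual_symm_apply]
    rw [← this, EuclideanSpace.inner_single_right]
    simp
  rw [EuclideanSpace.real_norm_sq_eq, Fin.sum_univ_two, h, h]

/-- the interpolation inequality
`∫ v⁴ ≤ 2 (∫ v²) (∫ ‖∇v‖²)` for `C¹` compactly supported `v : ℝ² → ℝ`. -/
theorem interpolation_inequality (v : E2 → ℝ)
    (hv : ContDiff ℝ 1 v) (hsupp : HasCompactSupport v) :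
    ∫ x : E2, v x ^ 4 ≤ 2 * (∫ x : E2, v x ^ 2) * ∫ x : E2, ‖gradient v x‖ ^ 2 := by
  let Φ : ℝ × ℝ → E2 := fun p => !₂[p.1, p.2]
  let eq : ℝ × ℝ ≃ᵐ E2 := MeasurableEquiv.finTwoArrow.symm.trans (MeasurableEquiv.toLp 2 (Fin 2 → ℝ))
  have heq : ⇑eq = Φ := rfl
  have mp : MeasurePreserving eq volume volume :=
    ((volume_preserving_finTwoArrow ℝ).symm _).trans
      (EuclideanSpace.volume_preserving_symm_measurableEquiv_toLp (Fin 2)).symm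
  have tr : ∀ g : E2 → ℝ, ∫ x, g x = ∫ p, g (Φ p) := fun g =>
    (mp.integral_comp eq.measurableEmbedding g).symm
  have cΦ : Continuous Φ := by fun_prop
  have hce : Topology.IsClosedEmbedding Φ := by
    refine Topology.IsClosedEmbedding.of_continuous_injective_isClosedMap cΦ eq.injective ?_
    let hom : ℝ × ℝ ≃ₜ E2 :=
      { toEquiv := eq.toEquiv
        continuous_toFun := cΦ
        continuous_invFun := by
          change Continuous (fun x : E2 => (x 0, x 1))
          fun_prop }
    exact hom.isClosedMap
  have hfd : Continuous (fderiv ℝ v) := hv.continuous_fderiv one_ne_zero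
  have sfd : HasCompactSupport (fderiv ℝ v) := hsupp.fderiv ℝ
  have cu : ∀ z : E2, Continuous fun p => fderiv ℝ v (Φ p) z := fun z => by fun_prop
  have su : ∀ z : E2, HasCompactSupport fun p => fderiv ℝ v (Φ p) z := fun z =>
    (sfd.comp_left (g := fun L : E2 →L[ℝ] ℝ => L z) rfl).comp_isClosedEmbedding hce
  have hdiff : ∀ x, HasFDerivAt v (fderiv ℝ v x) x := fun x =>
    (hv.differentiable one_ne_zero x).hasFDerivAt
  rw [tr, tr, tr]
  simp only [aux_grad v]
  refine aux_plane (fun p => v (Φ p)) _ _ (hv.continuous.comp cΦ) (cu _) (cu _)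
    (hsupp.comp_isClosedEmbedding hce) (su _) (su _) ?_ ?_
  · intro a b
    have hd : HasDerivAt (fun s => Φ (s, b)) (EuclideanSpace.single 0 1) a := by
      have : (fun s => Φ (s, b)) = fun s => Φ (0, b) + s • EuclideanSpace.single 0 (1:ℝ) := by
        funext s; ext i; fin_cases i <;> simp [Φ]
      rw [this]
      simpa using ((hasDerivAt_id a).smul_const (EuclideanSpace.single (0 : Fin 2) (1:ℝ))).const_add (Φ (0, b))
    exact (hdiff (Φ (a, b))).comp_hasDerivAt a hd
  · intro a b
    have hd : HasDerivAt (fun s => Φ (a, s)) (EuclideanSpace.single 1 1) b := by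
      have : (fun s => Φ (a, s)) = fun s => Φ (a, 0) + s • EuclideanSpace.single 1 (1:ℝ) := by
        funext s; ext i; fin_cases i <;> simp [Φ]
      rw [this]
      simpa using ((hasDerivAt_id b).smul_const (EuclideanSpace.single (1 : Fin 2) (1:ℝ))).const_add (Φ (a, 0))
    exact (hdiff (Φ (a, b))).comp_hasDerivAt b hd
end

section
/- There exists a constant C > 0 such that for every continuously differentiable, compactly supported function v : ℝ² → ℝ one has (∫_{ℝ²} v(x)² dx)^{1/2} ≤ C ( ∫_{ℝ²} v(x)²/(1+|v(x)|)² dx + ∫_{ℝ²} ‖∇v(x)‖² dx + 1 ). -/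
open MeasureTheory Real

lemma sq_supp {f : E2 → ℝ} (cf : HasCompactSupport f) : HasCompactSupport (fun x => f x ^ 2) :=
  cf.comp_left (g := fun y : ℝ => y ^ 2) (by norm_num)

lemma cs_aux (f g : E2 → ℝ) (hf : Continuous f) (hg : Continuous g)
    (cf : HasCompactSupport f) (cg : HasCompactSupport g) :
    (∫ x, f x * g x) ^ 2 ≤ (∫ x, f x ^ 2) * (∫ x, g x ^ 2) := by
  have i1 : Integrable (fun x => f x ^ 2) :=
    (hf.pow 2).integrable_of_hasCompactSupport (sq_supp cf)
  have i2 : Integrable (fun x => g x ^ 2) :=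
    (hg.pow 2).integrable_of_hasCompactSupport (sq_supp cg)
  have i3 : Integrable (fun x => f x * g x) :=
    (hf.mul hg).integrable_of_hasCompactSupport (cf.mul_right (f' := g))
  have key : ∀ t : ℝ, 0 ≤ (∫ x, f x ^ 2) * (t * t) + (2 * ∫ x, f x * g x) * t
      + (∫ x, g x ^ 2) := by
    intro t
    have h : 0 ≤ ∫ x, (f x * t + g x) ^ 2 := integral_nonneg fun x => sq_nonneg _
    have e : ∫ x, (f x * t + g x) ^ 2 = ∫ x, ((t * t) * f x ^ 2 + (2 * t) * (f x * g x) + g x ^ 2) := by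
      congr 1; ext x; ring
    have i4 : Integrable (fun x => (t * t) * f x ^ 2 + (2 * t) * (f x * g x)) :=
      (i1.const_mul _).add (i3.const_mul _)
    rw [e, integral_add i4 i2,
      integral_add (i1.const_mul _) (i3.const_mul _), integral_const_mul, integral_const_mul] at h
    linarith
  have := discrim_le_zero key
  unfold discrim at this
  nlinarith

lemma sob_aux : ∃ K : ℝ, 0 ≤ K ∧ ∀ u : E2 → ℝ, ContDiff ℝ 1 u → HasCompactSupport u →
    ∫ x, u x ^ 2 ≤ K * (∫ x, ‖fderiv ℝ u x‖) ^ 2 := by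
  have hp : (Module.finrank ℝ E2 : ℝ).HolderConjugate 2 := by
    simp only [finrank_euclideanSpace, Fintype.card_fin]
    exact_mod_cast Real.HolderConjugate.two_two
  refine ⟨lintegralPowLePowLIntegralFDerivConst (volume : Measure E2) 2, NNReal.coe_nonneg _, ?_⟩
  intro u hu cu
  have h := lintegral_pow_le_pow_lintegral_fderiv (volume : Measure E2) hu cu hp
  have cd : Continuous (fun x => ‖fderiv ℝ u x‖) := (hu.continuous_fderiv one_ne_zero).norm
  have id1 : Integrable (fun x => ‖fderiv ℝ u x‖) :=
    cd.integrable_of_hasCompactSupport (cu.fderiv (𝕜 := ℝ)).norm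
  have e2 : ENNReal.ofReal (∫ x, ‖fderiv ℝ u x‖) = ∫⁻ x, ‖fderiv ℝ u x‖ₑ := by
    rw [ofReal_integral_eq_lintegral_ofReal id1 (Filter.Eventually.of_forall fun x => norm_nonneg _)]
    simp only [ofReal_norm]
  have i1 : Integrable (fun x => u x ^ 2) :=
    (hu.continuous.pow 2).integrable_of_hasCompactSupport (sq_supp cu)
  have e1 : ENNReal.ofReal (∫ x, u x ^ 2) = ∫⁻ x, ‖u x‖ₑ ^ (2:ℝ) := by
    rw [ofReal_integral_eq_lintegral_ofReal i1 (Filter.Eventually.of_forall fun x => sq_nonneg _)]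
    congr 1; ext x
    rw [← ofReal_norm, ENNReal.rpow_two, ← ENNReal.ofReal_pow (norm_nonneg _)]
    simp
  rw [← e1, ← e2, ENNReal.rpow_two, ← ENNReal.ofReal_pow (integral_nonneg fun x => norm_nonneg _),
    ← ENNReal.ofReal_coe_nnreal, ← ENNReal.ofReal_mul (NNReal.coe_nonneg _)] at h
  exact (ENNReal.ofReal_le_ofReal_iff (by positivity)).1 h

/-- there is a constant `C > 0` such that for every `C¹` compactly
supported `v : ℝ² → ℝ`,
`‖v‖_{L²} ≤ C (∫ v²/(1+|v|)² + ∫ ‖∇v‖² + 1)`. -/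
theorem L2_control_inequality :
    ∃ C > (0 : ℝ), ∀ v : E2 → ℝ, ContDiff ℝ 1 v → HasCompactSupport v →
      Real.sqrt (∫ x : E2, v x ^ 2) ≤
        C * ((∫ x : E2, v x ^ 2 / (1 + |v x|) ^ 2) + (∫ x : E2, ‖gradient v x‖ ^ 2) + 1) := by
  obtain ⟨K, hK, hS⟩ := sob_aux
  refine ⟨8 * K + 3, by positivity, ?_⟩
  intro v hv cv
  have hc := hv.continuous
  have hng : ∀ x, ‖gradient v x‖ = ‖fderiv ℝ v x‖ := fun x => by
    simp [gradient]
  simp only [hng]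
  have cabs : HasCompactSupport (fun x => |v x|) := cv.norm
  have hpos : ∀ x, 0 < 1 + |v x| := fun x => by positivity
  set X := ∫ x, v x ^ 2 with hX
  set A := ∫ x, v x ^ 2 / (1 + |v x|) ^ 2 with hA
  set B := ∫ x, ‖fderiv ℝ v x‖ ^ 2 with hB
  have X0 : 0 ≤ X := integral_nonneg fun x => sq_nonneg _
  have A0 : 0 ≤ A := integral_nonneg fun x => by positivity
  have B0 : 0 ≤ B := integral_nonneg fun x => sq_nonneg _
  have cv2 : HasCompactSupport (fun x => v x ^ 2) := sq_supp cv
  have cv4 : HasCompactSupport (fun x => (v x ^ 2) ^ 2) := sq_supp cv2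
  have iX : Integrable (fun x => v x ^ 2) := (hc.pow 2).integrable_of_hasCompactSupport cv2
  have iF : Integrable (fun x => (v x ^ 2) ^ 2) :=
    ((hc.pow 2).pow 2).integrable_of_hasCompactSupport cv4
  -- fourth power bound
  have h4 : ∫ x, (v x ^ 2) ^ 2 ≤ K * (4 * (X * B)) := by
    refine (hS (fun x => v x ^ 2) (hv.pow 2) cv2).trans ?_
    refine mul_le_mul_of_nonneg_left ?_ hK
    have e : ∀ x, ‖fderiv ℝ (fun x => v x ^ 2) x‖ = 2 * (|v x| * ‖fderiv ℝ v x‖) := by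
      intro x
      have := ((hv.differentiable one_ne_zero x).hasFDerivAt.pow 2).fderiv
      rw [this]
      simp [norm_smul, mul_assoc]
    simp only [e]
    rw [integral_const_mul, mul_pow]
    have := cs_aux (fun x => |v x|) (fun x => ‖fderiv ℝ v x‖) hc.abs
      (hv.continuous_fderiv one_ne_zero).norm cabs (cv.fderiv (𝕜 := ℝ)).norm
    simp only [sq_abs] at this
    nlinarith
  have hG : ∫ x, (|v x| * (1 + |v x|)) ^ 2 ≤ 2 * X + 2 * ∫ x, (v x ^ 2) ^ 2 := by
    rw [hX, ← integral_const_mul, ← integral_const_mul,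
      ← integral_add (iX.const_mul _) (iF.const_mul _)]
    refine integral_mono_of_nonneg (Filter.Eventually.of_forall fun x => sq_nonneg _)
      ((iX.const_mul _).add (iF.const_mul _)) (Filter.Eventually.of_forall fun x => ?_)
    simp only
    rw [← sq_abs (v x)]
    nlinarith [mul_nonneg (sq_nonneg (|v x|)) (sq_nonneg (|v x| - 1))]
  have hX2 : X ^ 2 ≤ A * (2 * X + 2 * (K * (4 * (X * B)))) := by
    have h := cs_aux (fun x => |v x| * (1 + |v x|)⁻¹) (fun x => |v x| * (1 + |v x|))
      (hc.abs.mul ((continuous_const.add hc.abs).inv₀ fun x => (hpos x).ne'))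
      (hc.abs.mul (continuous_const.add hc.abs)) (cabs.mul_right) (cabs.mul_right)
    have e1 : ∀ x, |v x| * (1 + |v x|)⁻¹ * (|v x| * (1 + |v x|)) = v x ^ 2 := fun x => by
      rw [← sq_abs (v x)]; have := (hpos x).ne'; field_simp
    have e2 : ∀ x, (|v x| * (1 + |v x|)⁻¹) ^ 2 = v x ^ 2 / (1 + |v x|) ^ 2 := fun x => by
      rw [mul_pow, sq_abs, inv_pow, div_eq_mul_inv]
    simp only [e1, e2] at h
    exact h.trans (mul_le_mul_of_nonneg_left (by linarith) A0)
  have hX1 : X ≤ A * (2 + 8 * K * B) := by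
    rcases X0.eq_or_lt with h0 | h0
    · rw [← h0]; positivity
    · refine le_of_mul_le_mul_left ?_ h0
      nlinarith
  have hKA : 0 ≤ K * A := by positivity
  have hKB : 0 ≤ K * B := by positivity
  refine Real.sqrt_le_iff.2 ⟨by positivity, ?_⟩
  have h1 : X ≤ (A + (2 + 8 * K * B)) ^ 2 := by nlinarith
  refine h1.trans (pow_le_pow_left₀ (by positivity) ?_ 2)
  nlinarith
end

section
/- Let u⁰, h : ℝ² → ℝ be measurable with e^{u⁰} − 1 square-integrable, h square-integrable, and h(x) ≤ 1/2 almost everywhere, and let v : ℝ² → ℝ be measurable with v ≥ 0 almost everywhere, v square-integrable, and such that the function (1 − e^{u⁰−v} − h)·v is integrable. Then ∫_{ℝ²} (1 − e^{u⁰(x)−v(x)} − h(x)) v(x) dx ≥ (1/4)∫_{ℝ²} v(x)²/(1+v(x))² dx − ∫_{ℝ²} (1 − e^{u⁰(x)} − h(x))² dx. -/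
open MeasureTheory Real

theorem pointwise_aux (a h v : ℝ) (hh : h ≤ 1 / 2) (hv : 0 ≤ v) :
    (1 / 4) * (v ^ 2 / (1 + v) ^ 2) - (1 - Real.exp a - h) ^ 2 ≤
      (1 - Real.exp (a - v) - h) * v := by
  have hp : 0 < 1 + v := by linarith
  have hE : Real.exp (a - v) * (1 + v) ≤ Real.exp a := by
    have h1 : 1 + v ≤ Real.exp v := by linarith [Real.add_one_le_exp v]
    calc Real.exp (a - v) * (1 + v) ≤ Real.exp (a - v) * Real.exp v :=
          mul_le_mul_of_nonneg_left h1 (Real.exp_pos _).le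
      _ = Real.exp a := by rw [← Real.exp_add]; congr 1; ring
  rw [← div_pow]
  obtain ⟨w, hw⟩ : ∃ w, w = v / (1 + v) := ⟨_, rfl⟩
  rw [← hw]
  have hw0 : 0 ≤ w := by rw [hw]; positivity
  have hwv : w * (1 + v) = v := by rw [hw]; field_simp
  generalize Real.exp (a - v) = F at *
  generalize Real.exp a = A at *
  have h1 : F * v ≤ A * w := by
    calc F * v = w * (F * (1 + v)) := by linear_combination (-F) * hwv
      _ ≤ w * A := mul_le_mul_of_nonneg_left hE hw0
      _ = A * w := mul_comm _ _
  have h2 : w ^ 2 ≤ v - w := by nlinarith [mul_nonneg hw0 (mul_nonneg hw0 hv)]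
  have h3 : 0 ≤ (v - w) * (1 / 2 - h) :=
    mul_nonneg (by nlinarith) (by linarith)
  nlinarith [sq_nonneg (w / 2 + (1 - A - h))]

/-- lower bound for `∫ (1 − e^{u⁰−v} − h)·v` when `v ≥ 0` a.e. and
`h ≤ 1/2` a.e.: it is at least `(1/4)∫ v²/(1+v)² − ∫ (1 − e^{u⁰} − h)²`. -/
theorem lower_bound_G_minus (u0 h v : E2 → ℝ)
    (hu0 : Measurable u0)
    (hexp : Integrable (fun x => (Real.exp (u0 x) - 1) ^ 2))
    (hh : Measurable h) (hh2 : Integrable (fun x => h x ^ 2))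
    (hhle : ∀ᵐ x : E2, h x ≤ 1 / 2)
    (hv : Measurable v) (hv0 : ∀ᵐ x : E2, 0 ≤ v x)
    (hv2 : Integrable (fun x => v x ^ 2))
    (hint : Integrable (fun x => (1 - Real.exp (u0 x - v x) - h x) * v x)) :
    (1 / 4) * (∫ x : E2, v x ^ 2 / (1 + v x) ^ 2) -
        ∫ x : E2, (1 - Real.exp (u0 x) - h x) ^ 2 ≤
      ∫ x : E2, (1 - Real.exp (u0 x - v x) - h x) * v x := by
  have hw : Integrable (fun x : E2 => v x ^ 2 / (1 + v x) ^ 2) := by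
    refine hv2.mono' (Measurable.aestronglyMeasurable (by fun_prop)) ?_
    filter_upwards [hv0] with x hx
    rw [Real.norm_of_nonneg (by positivity)]
    exact div_le_self (sq_nonneg _) (by nlinarith)
  have hc : Integrable (fun x : E2 => (1 - Real.exp (u0 x) - h x) ^ 2) := by
    refine ((hexp.const_mul 2).add (hh2.const_mul 2)).mono' (by fun_prop) ?_
    filter_upwards with x
    rw [Real.norm_of_nonneg (by positivity)]
    simp only [Pi.add_apply]
    nlinarith [sq_nonneg ((Real.exp (u0 x) - 1) - h x)]
  rw [← integral_const_mul, ← integral_sub (hw.const_mul _) hc]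
  refine integral_mono_ae ((hw.const_mul _).sub hc) hint ?_
  filter_upwards [hhle, hv0] with x h1 h2
  exact pointwise_aux (u0 x) (h x) (v x) h1 h2
end

section
/- Let σ > 0, R > 0, and let w : ℝ² → ℝ be continuous, twice continuously differentiable on the exterior domain {x ∈ ℝ² : ‖x‖ > R}, with w(x) → 0 as ‖x‖ → ∞ and Δw(x) ≥ σ² w(x) for all ‖x‖ > R. Then there exists a constant C > 0 such that w(x) ≤ C e^{−σ‖x‖} for all x with ‖x‖ ≥ R. -/
open MeasureTheory Real Filter

lemma hasDerivAt_square (a : ℝ) : HasDerivAt (fun t : ℝ => t ^ 2) (2 * a) a := by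
  simpa using hasDerivAt_pow 2 a

lemma second_deriv_nonpos_of_localMax (g g' : ℝ → ℝ) (g2 : ℝ)
    (h1 : ∀ᶠ t in nhds (0:ℝ), HasDerivAt g (g' t) t) (h2 : HasDerivAt g' g2 0)
    (hm : IsLocalMax g 0) : g2 ≤ 0 := by
  by_contra! hpos
  have h0 : g' 0 = 0 := hm.hasDerivAt_eq_zero h1.self_of_nhds
  set k : ℝ → ℝ := fun t => g t - g2 / 4 * t ^ 2 with hk
  have hk1 : ∀ᶠ t in nhds (0:ℝ), HasDerivAt k (g' t - g2 / 2 * t) t := by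
    filter_upwards [h1] with t ht
    have := ht.sub ((hasDerivAt_square t).const_mul (g2 / 4))
    refine HasDerivAt.congr_deriv this ?_
    ring
  have hk1' : deriv k =ᶠ[nhds 0] fun t => g' t - g2 / 2 * t := by
    filter_upwards [hk1] with t ht using ht.deriv
  have hk2 : HasDerivAt (fun t => g' t - g2 / 2 * t) (g2 - g2 / 2 * 1) 0 :=
    h2.sub ((hasDerivAt_id (0:ℝ)).const_mul (g2 / 2))
  have hmin : IsLocalMin k 0 := by
    apply isLocalMin_of_deriv_deriv_pos
    · rw [hk1'.deriv_eq, hk2.deriv]; linarith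
    · rw [hk1'.self_of_nhds]; simp [h0]
    · exact hk1.self_of_nhds.continuousAt
  have hev : ∀ᶠ t in nhds (0:ℝ), t = 0 := by
    filter_upwards [hmin, hm] with t a b
    simp only [hk] at a
    by_contra hne
    have : 0 < t ^ 2 := by positivity
    nlinarith
  obtain ⟨ε, hε, hb⟩ := Metric.eventually_nhds_iff.1 hev
  have := hb (y := ε / 2) (by rw [Real.dist_eq, sub_zero, abs_of_pos (by linarith)]; linarith)
  linarith

lemma radial_line_deriv (σ a b : ℝ) (hs : 0 < a ^ 2 + b ^ 2) :
    HasDerivAt (fun t => Real.exp (-σ * √(t ^ 2 + b ^ 2)))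
      (-σ * (a / √(a ^ 2 + b ^ 2)) * Real.exp (-σ * √(a ^ 2 + b ^ 2))) a := by
  have h := (((hasDerivAt_square a).add_const (b ^ 2)).sqrt hs.ne').const_mul (-σ) |>.exp
  have hs' : 0 < √(a ^ 2 + b ^ 2) := Real.sqrt_pos.2 hs
  convert h using 1
  field_simp

lemma radial_line_deriv2 (σ a b : ℝ) (hs : 0 < a ^ 2 + b ^ 2) :
    HasDerivAt (fun t => -σ * (t / √(t ^ 2 + b ^ 2)) * Real.exp (-σ * √(t ^ 2 + b ^ 2)))
      ((σ ^ 2 * (a ^ 2 / (a ^ 2 + b ^ 2)) - σ * (b ^ 2 / (√(a ^ 2 + b ^ 2)) ^ 3))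
        * Real.exp (-σ * √(a ^ 2 + b ^ 2))) a := by
  have hq := ((hasDerivAt_square a).add_const (b ^ 2)).sqrt hs.ne'
  have hs' : 0 < √(a ^ 2 + b ^ 2) := Real.sqrt_pos.2 hs
  have h := (((hasDerivAt_id' a).div hq hs'.ne').const_mul (-σ)).mul (radial_line_deriv σ a b hs)
  refine HasDerivAt.congr_deriv h ?_
  simp only [Pi.div_apply]
  have e : a ^ 2 + b ^ 2 = √(a ^ 2 + b ^ 2) ^ 2 := (Real.sq_sqrt hs.le).symm
  generalize √(a ^ 2 + b ^ 2) = s at *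
  rw [e]
  have eb : b ^ 2 = s ^ 2 - a ^ 2 := by linarith
  rw [eb]
  field_simp
  ring

/-- One coordinate direction at a local maximum. -/
lemma dir_second (σ C : ℝ) (w : E2 → ℝ) (x : E2) (hx : x ≠ 0) (hw : ContDiffAt ℝ 2 w x)
    (hm : IsLocalMax (fun y => w y - C * Real.exp (-σ * ‖y‖)) x) (i j : Fin 2) (hij : i ≠ j) :
    fderiv ℝ (fun y => fderiv ℝ w y (EuclideanSpace.single i 1)) x (EuclideanSpace.single i 1)
     ≤ C * ((σ ^ 2 * (x i ^ 2 / ‖x‖ ^ 2) - σ * (x j ^ 2 / ‖x‖ ^ 3)) * Real.exp (-σ * ‖x‖)) := by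
  set e : E2 := EuclideanSpace.single i 1 with he
  have hnorm : ∀ t : ℝ, ‖x + t • e‖ = √((x i + t) ^ 2 + x j ^ 2) := by
    intro t
    rw [EuclideanSpace.norm_eq]
    congr 1
    fin_cases i <;> fin_cases j <;> simp_all [add_comm]
  have hnx : ‖x‖ = √(x i ^ 2 + x j ^ 2) := by simpa using hnorm 0
  have hpos : 0 < x i ^ 2 + x j ^ 2 := Real.sqrt_pos.1 (hnx ▸ norm_pos_iff.2 hx)
  have hline : ∀ t : ℝ, HasDerivAt (fun t : ℝ => x + t • e) e t := by
    intro t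
    simpa using ((hasDerivAt_id t).smul_const e).const_add x
  have hcont : Tendsto (fun t : ℝ => x + t • e) (nhds 0) (nhds x) := by
    simpa using (hline 0).continuousAt.tendsto
  have hwev : ∀ᶠ y in nhds x, DifferentiableAt ℝ w y := by
    filter_upwards [hw.eventually (by simp)] with y hy using hy.differentiableAt (by simp)
  have hd2 : DifferentiableAt ℝ (fun y => fderiv ℝ w y e) x := by
    have := (hw.fderiv_right (m := 1) (by norm_num)).differentiableAt (by simp)
    exact this.clm_apply (differentiableAt_const e)
  have hshift : ∀ t : ℝ, HasDerivAt (fun t : ℝ => x i + t) 1 t := fun t => by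
    simpa using (hasDerivAt_id t).const_add (x i)
  have hpos' : ∀ᶠ t in nhds (0:ℝ), 0 < (x i + t) ^ 2 + x j ^ 2 := by
    have : ContinuousAt (fun t : ℝ => (x i + t) ^ 2 + x j ^ 2) 0 := by fun_prop
    exact this.eventually (lt_mem_nhds (by simpa using hpos))
  have key := second_deriv_nonpos_of_localMax
    (fun t => w (x + t • e) - C * Real.exp (-σ * √((x i + t) ^ 2 + x j ^ 2)))
    (fun t => fderiv ℝ w (x + t • e) e - C * (-σ * ((x i + t) / √((x i + t) ^ 2 + x j ^ 2)) *
      Real.exp (-σ * √((x i + t) ^ 2 + x j ^ 2))))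
    (fderiv ℝ (fun y => fderiv ℝ w y e) x e - C * ((σ ^ 2 * (x i ^ 2 / (x i ^ 2 + x j ^ 2)) -
      σ * (x j ^ 2 / (√(x i ^ 2 + x j ^ 2)) ^ 3)) * Real.exp (-σ * √(x i ^ 2 + x j ^ 2))))
    ?_ ?_ ?_
  · have : ‖x‖ ^ 2 = x i ^ 2 + x j ^ 2 := by rw [hnx, Real.sq_sqrt hpos.le]
    rw [this, hnx]
    linarith
  · filter_upwards [hcont.eventually hwev, hpos'] with t ht hp
    refine (ht.hasFDerivAt.comp_hasDerivAt t (hline t)).sub (HasDerivAt.const_mul C ?_)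
    simpa [Function.comp_def] using (radial_line_deriv σ (x i + t) (x j) hp).comp t (hshift t)
  · refine HasDerivAt.sub ?_ (HasDerivAt.const_mul C ?_)
    · have h0 : HasFDerivAt (fun y => fderiv ℝ w y e) (fderiv ℝ (fun y => fderiv ℝ w y e) x)
          (x + (0:ℝ) • e) := by simpa using hd2.hasFDerivAt
      exact h0.comp_hasDerivAt (0:ℝ) (hline 0)
    · have h := radial_line_deriv2 σ (x i + 0) (x j) (by simpa using hpos)
      simpa [Function.comp_def] using h.comp (0:ℝ) (hshift 0)
  · have := hcont.eventually hm
    filter_upwards [this] with t ht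
    simpa [hnorm, hnx] using ht

/-- if `w` is continuous, `C²` on the exterior domain `{‖x‖ > R}`,
tends to `0` at infinity and satisfies `Δw ≥ σ²w` there, then `w(x) ≤ C e^{−σ‖x‖}`
for `‖x‖ ≥ R`, for some constant `C > 0`. -/
theorem maximum_principle_exponential_decay (σ R : ℝ) (hσ : 0 < σ) (hR : 0 < R)
    (w : E2 → ℝ) (hw : Continuous w)
    (hw2 : ContDiffOn ℝ 2 w {x : E2 | R < ‖x‖})
    (hlim : Tendsto w (cocompact E2) (nhds 0))
    (hineq : ∀ x : E2, R < ‖x‖ → σ ^ 2 * w x ≤ lap w x) :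
    ∃ C > (0 : ℝ), ∀ x : E2, R ≤ ‖x‖ → w x ≤ C * Real.exp (-σ * ‖x‖) := by
  set K : Set E2 := Metric.closedBall 0 R
  obtain ⟨M, hM⟩ := (isCompact_closedBall (0:E2) R).bddAbove_image hw.continuousOn
  have hM' : ∀ x : E2, ‖x‖ ≤ R → w x ≤ M := fun x hx =>
    hM ⟨x, by simpa using hx, rfl⟩
  set C : ℝ := (|M| + 1) * Real.exp (σ * R) with hC
  have hCpos : 0 < C := by positivity
  refine ⟨C, hCpos, ?_⟩
  set u : E2 → ℝ := fun y => w y - C * Real.exp (-σ * ‖y‖) with hu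
  have hucont : Continuous u := by fun_prop
  have hubd : ∀ x : E2, ‖x‖ ≤ R → u x ≤ 0 := by
    intro x hx
    have h1 := hM' x hx
    have h2 : Real.exp (-σ * R) ≤ Real.exp (-σ * ‖x‖) := Real.exp_le_exp.2 (by nlinarith)
    have h3 : C * Real.exp (-σ * R) = |M| + 1 := by
      rw [hC, mul_assoc, ← Real.exp_add]; simp
    have h4 := mul_le_mul_of_nonneg_left h2 hCpos.le
    have := le_abs_self M
    simp only [hu]; linarith
  by_contra! hcon
  obtain ⟨z, -, hz⟩ := hcon
  have huz : 0 < u z := by simp only [hu]; linarith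
  have hmax : ∃ x, ∀ y, u y ≤ u x := by
    apply hucont.exists_forall_ge' z
    filter_upwards [hlim.eventually (gt_mem_nhds huz)] with y hy
    have : 0 < C * Real.exp (-σ * ‖y‖) := by positivity
    simp only [hu] at hy ⊢; linarith
  obtain ⟨x, hx⟩ := hmax
  have hux : 0 < u x := huz.trans_le (hx z)
  have hxR : R < ‖x‖ := by
    by_contra! h
    linarith [hubd x h]
  have hx0 : x ≠ 0 := norm_pos_iff.1 (hR.trans hxR)
  have hcd : ContDiffAt ℝ 2 w x :=
    hw2.contDiffAt ((isOpen_lt continuous_const continuous_norm).mem_nhds hxR)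
  have hm : IsLocalMax u x := Eventually.of_forall hx
  have d0 := dir_second σ C w x hx0 hcd hm 0 1 (by simp)
  have d1 := dir_second σ C w x hx0 hcd hm 1 0 (by simp)
  have hi := hineq x hxR
  rw [lap, Fin.sum_univ_two] at hi
  have hn : ‖x‖ ^ 2 = x 0 ^ 2 + x 1 ^ 2 := by
    rw [EuclideanSpace.norm_sq_eq]; simp
  have hr : 0 < ‖x‖ := hR.trans hxR
  have hE : 0 < Real.exp (-σ * ‖x‖) := Real.exp_pos _
  have hsum : C * ((σ ^ 2 * (x 0 ^ 2 / ‖x‖ ^ 2) - σ * (x 1 ^ 2 / ‖x‖ ^ 3)) * Real.exp (-σ * ‖x‖))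
      + C * ((σ ^ 2 * (x 1 ^ 2 / ‖x‖ ^ 2) - σ * (x 0 ^ 2 / ‖x‖ ^ 3)) * Real.exp (-σ * ‖x‖))
      = σ ^ 2 * (C * Real.exp (-σ * ‖x‖)) - C * (σ / ‖x‖) * Real.exp (-σ * ‖x‖) := by
    have h0 : x 0 ^ 2 = ‖x‖ ^ 2 - x 1 ^ 2 := by linarith
    rw [h0]
    field_simp
    ring
  have hp : 0 < C * (σ / ‖x‖) * Real.exp (-σ * ‖x‖) := by positivity
  have hq : 0 < σ ^ 2 * u x := by positivity
  simp only [hu] at hq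
  linarith
end
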